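/- Let G be a plane graph with outer cycle C, let v₁, v₂ ∈ V(C), and let L be a list-assignment for G such that |L(v)| ≥ 5 for all v ∈ V(G) \ V(C), |L(v)| ≥ 3 for all v ∈ V(C) \ {v₁, v₂}, and |L(v₁)| = |L(v₂)| = 2. Then G is L-colorable. -/

import Mathlib

open Set Topology

/-- A plane embedding (drawing) of a simple graph: vertices are distinct points of the
plane and each edge is drawn as a simple arc joining the images of its endpoints;
an arc passes through no vertex other than its endpoints, and two distinct arcs
meet only at images of common endpoints. -/
structure PlaneEmbedding {V : Type*} (G : SimpleGraph V) where
  pos : V → ℝ × ℝ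
  arc : Sym2 V → Set (ℝ × ℝ)
  pos_inj : Function.Injective pos
  arc_is_arc : ∀ e ∈ G.edgeSet, ∃ γ : ℝ → ℝ × ℝ,
    ContinuousOn γ (Icc 0 1) ∧ InjOn γ (Icc 0 1) ∧ γ '' (Icc 0 1) = arc e ∧
    ∀ u v : V, e = s(u, v) → ({γ 0, γ 1} : Set (ℝ × ℝ)) = {pos u, pos v}
  arc_inter_pos : ∀ e ∈ G.edgeSet, ∀ v : V, pos v ∈ arc e → v ∈ e
  arc_inter_arc : ∀ e ∈ G.edgeSet, ∀ f ∈ G.edgeSet, e ≠ f →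
    ∀ p ∈ arc e ∩ arc f, ∃ v : V, v ∈ e ∧ v ∈ f ∧ pos v = p

namespace PlaneEmbedding

variable {V : Type*} {G : SimpleGraph V} (E : PlaneEmbedding G)

/-- The point set of the drawing. -/
def image : Set (ℝ × ℝ) := Set.range E.pos ∪ ⋃ e ∈ G.edgeSet, E.arc e

/-- The outer (unbounded) face: the set of points of the complement of the drawing
whose connected component in the complement is unbounded. -/
def outerFace : Set (ℝ × ℝ) :=
  {x | x ∉ E.image ∧ ¬ Bornology.IsBounded (connectedComponentIn E.imageᶜ x)}

/-- A vertex is incident with the outer face if its image lies in the closure of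
the outer face. -/
def IncOuter (v : V) : Prop := E.pos v ∈ closure E.outerFace

/-- `C` is the outer cycle of the drawing: a cycle in `G` whose drawing is exactly
the boundary of the outer face. -/
def IsOuterCycle {w : V} (C : G.Walk w w) : Prop :=
  C.IsCycle ∧ (⋃ e ∈ C.edges, E.arc e) = frontier E.outerFace

end PlaneEmbedding

/-- `φ` is a proper coloring of `G` from the lists `L`. -/
def IsLColoring {V : Type*} (G : SimpleGraph V) (L : V → Finset ℕ) (φ : V → ℕ) : Prop :=
  (∀ v : V, φ v ∈ L v) ∧ ∀ ⦃u w : V⦄, G.Adj u w → φ u ≠ φ w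

/-- `(G, S, L)` (with drawing `E`) is a canvas: `S` is a subgraph of the boundary of
the outer face, lists are nonempty, have size at least `5` off the outer face, size
at least `3` outside `S`, and `S` has a proper `L`-coloring. -/
def IsCanvas {V : Type*} (G : SimpleGraph V) (E : PlaneEmbedding G) (S : G.Subgraph)
    (L : V → Finset ℕ) : Prop :=
  (∀ v : V, (L v).Nonempty) ∧
  (∀ v ∈ S.verts, E.pos v ∈ frontier E.outerFace) ∧
  (∀ e ∈ S.edgeSet, E.arc e ⊆ frontier E.outerFace) ∧
  (∀ v : V, ¬ E.IncOuter v → 5 ≤ (L v).card) ∧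
  (∀ v : V, v ∉ S.verts → 3 ≤ (L v).card) ∧
  (∃ φ : V → ℕ, (∀ v ∈ S.verts, φ v ∈ L v) ∧ ∀ ⦃x y : V⦄, S.Adj x y → φ x ≠ φ y)

/-- A canvas is critical if `G` is not `L`-colorable but deleting any edge not in `S`
yields an `L`-colorable graph. -/
def IsCritical {V : Type*} (G : SimpleGraph V) (S : SimpleGraph.Subgraph G)
    (L : V → Finset ℕ) : Prop :=
  (¬ ∃ φ : V → ℕ, IsLColoring G L φ) ∧
  ∀ e ∈ G.edgeSet, e ∉ S.edgeSet →
    ∃ φ : V → ℕ, IsLColoring (G.deleteEdges {e}) L φ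

/-- `v` is a cutvertex of `G`: some two vertices distinct from `v` are connected in
`G`, but every walk between them passes through `v`. -/
def IsCutvertex {V : Type*} (G : SimpleGraph V) (v : V) : Prop :=
  ∃ x y : V, x ≠ v ∧ y ≠ v ∧ G.Reachable x y ∧ ∀ W : G.Walk x y, v ∈ W.support

/-- `G` is 2-connected: connected with no cutvertex. -/
def TwoConnected {V : Type*} (G : SimpleGraph V) : Prop :=
  G.Connected ∧ ∀ v : V, ¬ IsCutvertex G v

/-- The edge `uv` is a chord of the outer walk of the drawing `E`: an edge of `G`
joining two vertices on the boundary of the outer face that is not itself drawn on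
that boundary. -/
def IsChord {V : Type*} {G : SimpleGraph V} (E : PlaneEmbedding G) (u v : V) : Prop :=
  G.Adj u v ∧ E.pos u ∈ frontier E.outerFace ∧ E.pos v ∈ frontier E.outerFace ∧
    ¬ E.arc s(u, v) ⊆ frontier E.outerFace

/-- A cutvertex `v` is essential (with respect to `S`) if whenever `G = G₁ ∪ G₂` with
`V(G₁), V(G₂) ≠ V(G)` and `V(G₁) ∩ V(G₂) = {v}`, neither `Gᵢ` contains all of `V(S)`. -/
def EssentialCutvertex {V : Type*} (G : SimpleGraph V) (S : SimpleGraph.Subgraph G)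
    (v : V) : Prop :=
  ∀ H₁ H₂ : SimpleGraph.Subgraph G, H₁ ⊔ H₂ = ⊤ →
    H₁.verts ≠ Set.univ → H₂.verts ≠ Set.univ → H₁.verts ∩ H₂.verts = {v} →
    ¬ S.verts ⊆ H₁.verts ∧ ¬ S.verts ⊆ H₂.verts

/-- A chord `uv` is essential (with respect to `S`) if whenever `G = G₁ ∪ G₂` with
`V(G₁), V(G₂) ≠ V(G)` and `V(G₁) ∩ V(G₂) = {u, v}`, neither `Gᵢ` contains all of `V(S)`. -/
def EssentialChord {V : Type*} (G : SimpleGraph V) (S : SimpleGraph.Subgraph G)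
    (u v : V) : Prop :=
  ∀ H₁ H₂ : SimpleGraph.Subgraph G, H₁ ⊔ H₂ = ⊤ →
    H₁.verts ≠ Set.univ → H₂.verts ≠ Set.univ → H₁.verts ∩ H₂.verts = {u, v} →
    ¬ S.verts ⊆ H₁.verts ∧ ¬ S.verts ⊆ H₂.verts

/-- The edge `xy` of `G` separates `s` from `t`: `s` and `t` lie in different
components of `G ∖ {x, y}`. -/
def SeparatesEdge {V : Type*} (G : SimpleGraph V) (x y s t : V) : Prop :=
  s ≠ x ∧ s ≠ y ∧ t ≠ x ∧ t ≠ y ∧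
    ∀ W : G.Walk s t, x ∈ W.support ∨ y ∈ W.support

namespace TL

section comb
variable {W : Type} (Γ : SimpleGraph W)

/-- reachability from `r` by steps landing in `M` -/
def Rch (M : Set W) (r x : W) : Prop :=
  Relation.ReflTransGen (fun u v => Γ.Adj u v ∧ v ∈ M) r x

/-- nonempty connected vertex set -/
def Conn (S : Set W) : Prop := ∃ r ∈ S, ∀ x ∈ S, Rch Γ S r x

def SAdj (A B : Set W) : Prop := ∃ a ∈ A, ∃ b ∈ B, Γ.Adj a b

def HasMinor (m : ℕ) (R : Fin m → Fin m → Prop) : Prop :=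
  ∃ S : Fin m → Set W, (∀ i, Conn Γ (S i)) ∧ (∀ i j, i ≠ j → Disjoint (S i) (S j)) ∧
    ∀ i j, i < j → R i j → SAdj Γ (S i) (S j)

/-- no K5 and no K33 minor -/
def NoMin : Prop := ¬ HasMinor Γ 5 (fun _ _ => True) ∧
  ¬ HasMinor Γ 6 (fun i j => i.val < 3 ∧ 3 ≤ j.val)

variable {Γ}

lemma Rch.mem {M : Set W} {r x : W} (h : Rch Γ M r x) (hr : r ∈ M) : x ∈ M := by
  induction h with
  | refl => exact hr
  | tail _ h _ => exact h.2

lemma Rch.symm {M : Set W} {r x : W} (h : Rch Γ M r x) (hr : r ∈ M) : Rch Γ M x r := by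
  induction h with
  | refl => exact .refl
  | @tail b c h1 h2 ih =>
    have hb : b ∈ M := Rch.mem h1 hr
    exact Relation.ReflTransGen.head ⟨h2.1.symm, hb⟩ ih

lemma Rch.trans {M : Set W} {r x y : W} (h : Rch Γ M r x) (h' : Rch Γ M x y) : Rch Γ M r y :=
  Relation.ReflTransGen.trans h h'

lemma Rch.mono {M N : Set W} (hMN : M ⊆ N) {r x : W} (h : Rch Γ M r x) : Rch Γ N r x :=
  Relation.ReflTransGen.mono (fun _ _ h => ⟨h.1, hMN h.2⟩) _ _ h

lemma Rch.comp {M : Set W} {r x : W} (h : Rch Γ M r x) : Rch Γ {y | Rch Γ M r y} r x := by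
  induction h with
  | refl => exact .refl
  | tail h1 h2 ih => exact Relation.ReflTransGen.tail ih ⟨h2.1, Relation.ReflTransGen.tail h1 h2⟩

lemma conn_comp (M : Set W) (r : W) : Conn Γ {y | Rch Γ M r y} :=
  ⟨r, Relation.ReflTransGen.refl, fun _ hx => Rch.comp hx⟩

lemma conn_singleton (x : W) : Conn Γ {x} := by
  refine ⟨x, rfl, ?_⟩
  rintro y rfl
  exact .refl

lemma Conn.union_of_adj {S T : Set W} (hS : Conn Γ S) (hT : Conn Γ T) (h : SAdj Γ S T) :
    Conn Γ (S ∪ T) := by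
  obtain ⟨r, hr, hS⟩ := hS
  obtain ⟨q, hq, hT⟩ := hT
  obtain ⟨a, ha, b, hb, hab⟩ := h
  refine ⟨r, Or.inl hr, ?_⟩
  have h1 : Rch Γ (S ∪ T) r b :=
    Relation.ReflTransGen.tail ((hS a ha).mono subset_union_left) ⟨hab, Or.inr hb⟩
  rintro x (hx | hx)
  · exact (hS x hx).mono subset_union_left
  · exact h1.trans ((((hT b hb).symm hq).trans (hT x hx)).mono subset_union_right)

lemma Conn.union_attached {S : Set W} (hS : Conn Γ S) (P : Set W)
    (h : ∀ p ∈ P, ∃ s ∈ S, Γ.Adj s p) : Conn Γ (S ∪ P) := by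
  obtain ⟨r, hr, hS⟩ := hS
  refine ⟨r, Or.inl hr, ?_⟩
  rintro x (hx | hx)
  · exact (hS x hx).mono subset_union_left
  · obtain ⟨s, hs, hsx⟩ := h x hx
    exact Relation.ReflTransGen.tail ((hS s hs).mono subset_union_left) ⟨hsx, Or.inr hx⟩

/-- link lemma -/
lemma link {M N : Set W} {n1 n2 : W} (hN : N ⊆ M ∪ {n1, n2}) (h : Rch Γ N n1 n2) (hne : n1 ≠ n2) :
    ∃ K : Set W, K ⊆ M ∧ Conn Γ ({n1} ∪ K) ∧ SAdj Γ ({n1} ∪ K) {n2} ∧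
      (K = ∅ ∨ ∃ y ∈ M, K = {x | Rch Γ M y x} ∧ SAdj Γ K {n1} ∧ SAdj Γ K {n2}) := by
  have key : Γ.Adj n1 n2 ∨ ∃ y ∈ M, ∃ y' ∈ M, Γ.Adj n1 y ∧ Rch Γ M y y' ∧ Γ.Adj y' n2 := by
    have : ∀ x, Rch Γ N n1 x → x = n1 ∨
        (Γ.Adj n1 n2 ∨ ∃ y ∈ M, ∃ y' ∈ M, Γ.Adj n1 y ∧ Rch Γ M y y' ∧ Γ.Adj y' n2) ∨
        (x ∈ M ∧ ∃ y ∈ M, Γ.Adj n1 y ∧ Rch Γ M y x) := by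
      intro x hx
      induction hx with
      | refl => exact Or.inl rfl
      | @tail b c h1 h2 ih =>
        obtain ⟨hbc, hc⟩ := h2
        rcases ih with rfl | ih | ⟨hb, y, hy, hny, hyb⟩
        · rcases hN hc with hc | rfl | hc
          · exact Or.inr (Or.inr ⟨hc, c, hc, hbc, .refl⟩)
          · exact Or.inl rfl
          · rw [mem_singleton_iff] at hc; subst hc; exact Or.inr (Or.inl (Or.inl hbc))
        · exact Or.inr (Or.inl ih)
        · rcases hN hc with hc | rfl | hc
          · exact Or.inr (Or.inr ⟨hc, y, hy, hny, Relation.ReflTransGen.tail hyb ⟨hbc, hc⟩⟩)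
          · exact Or.inl rfl
          · rw [mem_singleton_iff] at hc; subst hc
            exact Or.inr (Or.inl (Or.inr ⟨y, hy, b, hb, hny, hyb, hbc⟩))
    by_cases hc : (Γ.Adj n1 n2 ∨ ∃ y ∈ M, ∃ y' ∈ M, Γ.Adj n1 y ∧ Rch Γ M y y' ∧ Γ.Adj y' n2)
    · exact hc
    · -- rerun: the end must be in M
      rcases this n2 h with h | h | ⟨hm, y, hy, hny, hyb⟩
      · exact absurd h.symm hne
      · exact h
      · rcases Relation.ReflTransGen.cases_tail hyb with h' | ⟨z, hz, hzn⟩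
        · exact Or.inl (h' ▸ hny)
        · exact Or.inr ⟨y, hy, z, Rch.mem hz hy, hny, hz, hzn.1⟩
  rcases key with h | ⟨y, hy, y', hy', h1, h2, h3⟩
  · refine ⟨∅, by simp, ?_, ?_, Or.inl rfl⟩
    · rw [union_empty]; exact conn_singleton n1
    · exact ⟨n1, by simp, n2, rfl, h⟩
  · refine ⟨{x | Rch Γ M y x}, fun x hx => Rch.mem hx hy, ?_, ?_, Or.inr ⟨y, hy, rfl, ?_, ?_⟩⟩
    · exact (conn_singleton n1).union_of_adj (conn_comp M y) ⟨n1, rfl, y, .refl, h1⟩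
    · exact ⟨y', Or.inr h2, n2, rfl, h3⟩
    · exact ⟨y, .refl, n1, rfl, h1.symm⟩
    · exact ⟨y', h2, n2, rfl, h3⟩

lemma comp_eq {M : Set W} {y z x : W} (hy : y ∈ M) (hz : z ∈ M) (h1 : Rch Γ M y x)
    (h2 : Rch Γ M z x) : {t | Rch Γ M y t} = {t | Rch Γ M z t} := by
  ext t
  exact ⟨fun h => (h2.trans (h1.symm hy)).trans h, fun h => (h1.trans (h2.symm hz)).trans h⟩

lemma noK5 (hΓ : NoMin Γ) (A B C D F : Set W) (hA : Conn Γ A) (hB : Conn Γ B) (hC : Conn Γ C)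
    (hD : Conn Γ D) (hF : Conn Γ F) (dAB : Disjoint A B) (dAC : Disjoint A C) (dAD : Disjoint A D)
    (dAF : Disjoint A F) (dBC : Disjoint B C) (dBD : Disjoint B D) (dBF : Disjoint B F)
    (dCD : Disjoint C D) (dCF : Disjoint C F) (dDF : Disjoint D F)
    (aAB : SAdj Γ A B) (aAC : SAdj Γ A C) (aAD : SAdj Γ A D)
    (aAF : SAdj Γ A F) (aBC : SAdj Γ B C) (aBD : SAdj Γ B D) (aBF : SAdj Γ B F)
    (aCD : SAdj Γ C D) (aCF : SAdj Γ C F) (aDF : SAdj Γ D F) : False := by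
  apply hΓ.1
  refine ⟨![A, B, C, D, F], ?_, ?_, ?_⟩
  · intro i; fin_cases i <;> assumption
  · intro i j hij
    fin_cases i <;> fin_cases j <;> first | exact absurd rfl hij | assumption | (apply Disjoint.symm; assumption)
  · intro i j hij _
    fin_cases i <;> fin_cases j <;> first | exact absurd hij (by decide) | assumption

lemma noK33 (hΓ : NoMin Γ) (A B C D F G : Set W) (hA : Conn Γ A) (hB : Conn Γ B) (hC : Conn Γ C)
    (hD : Conn Γ D) (hF : Conn Γ F) (hG : Conn Γ G)
    (dAB : Disjoint A B) (dAC : Disjoint A C) (dAD : Disjoint A D)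
    (dAF : Disjoint A F) (dAG : Disjoint A G) (dBC : Disjoint B C) (dBD : Disjoint B D)
    (dBF : Disjoint B F) (dBG : Disjoint B G)
    (dCD : Disjoint C D) (dCF : Disjoint C F) (dCG : Disjoint C G) (dDF : Disjoint D F)
    (dDG : Disjoint D G) (dFG : Disjoint F G)
    (aAD : SAdj Γ A D) (aAF : SAdj Γ A F) (aAG : SAdj Γ A G)
    (aBD : SAdj Γ B D) (aBF : SAdj Γ B F) (aBG : SAdj Γ B G)
    (aCD : SAdj Γ C D) (aCF : SAdj Γ C F) (aCG : SAdj Γ C G) : False := by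
  apply hΓ.2
  refine ⟨![A, B, C, D, F, G], ?_, ?_, ?_⟩
  · intro i; fin_cases i <;> assumption
  · intro i j hij
    fin_cases i <;> fin_cases j <;> first | exact absurd rfl hij | assumption | (apply Disjoint.symm; assumption)
  · intro i j hij hR
    fin_cases i <;> fin_cases j <;>
      first | exact absurd hij (by decide) | exact absurd hR (by decide) | assumption

/-- a state: current vertices `U`, boundary `B`, hub set `S` -/
structure St (Γ : SimpleGraph W) (U B : Finset W) (S : Set W) : Prop where
  sub : B ⊆ U
  conn : Conn Γ S
  disj : ∀ x ∈ U, x ∉ S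
  hub : ∀ b ∈ B, ∃ s ∈ S, Γ.Adj s b

open Classical in
/-- no separating edge in the boundary -/
def NS (Γ : SimpleGraph W) (U B : Finset W) : Prop :=
  ∀ x ∈ B, ∀ y ∈ B, Γ.Adj x y → ∀ K₁ K₂ : Finset W, K₁ ∪ K₂ = U \ {x, y} → Disjoint K₁ K₂ →
    (∀ a ∈ K₁, ∀ b ∈ K₂, ¬ Γ.Adj a b) → K₁ = ∅ ∨ K₂ = ∅

open Classical in
lemma NS.rch {U B : Finset W} (h : NS Γ U B) {x y a b : W} (hx : x ∈ B) (hy : y ∈ B)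
    (hxy : Γ.Adj x y) (ha : a ∈ U) (hax : a ≠ x) (hay : a ≠ y) (hb : b ∈ U) (hbx : b ≠ x)
    (hby : b ≠ y) : Rch Γ {z | z ∈ U ∧ z ≠ x ∧ z ≠ y} a b := by
  by_contra hc
  set M : Set W := {z | z ∈ U ∧ z ≠ x ∧ z ≠ y} with hM
  have haM : a ∈ M := ⟨ha, hax, hay⟩
  have hbM : b ∈ M := ⟨hb, hbx, hby⟩
  have key : ∀ c ∈ (U \ {x, y}).filter (fun z => Rch Γ M a z),
      ∀ d ∈ (U \ {x, y}).filter (fun z => ¬ Rch Γ M a z), ¬ Γ.Adj c d := by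
    intro c hc d hd hcd
    simp only [Finset.mem_filter, Finset.mem_sdiff, Finset.mem_insert, Finset.mem_singleton,
      not_or] at hc hd
    exact hd.2 (Relation.ReflTransGen.tail hc.2 ⟨hcd, hd.1.1, hd.1.2⟩)
  rcases h x hx y hy hxy ((U \ {x, y}).filter (fun z => Rch Γ M a z))
    ((U \ {x, y}).filter (fun z => ¬ Rch Γ M a z)) (Finset.filter_union_filter_not_eq _ _)
    (Finset.disjoint_filter_filter_not _ _ _) key with h | h
  · have : a ∈ (U \ {x, y}).filter (fun z => Rch Γ M a z) := by
      simp only [Finset.mem_filter, Finset.mem_sdiff, Finset.mem_insert, Finset.mem_singleton, not_or]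
      exact ⟨⟨ha, hax, hay⟩, Relation.ReflTransGen.refl⟩
    rw [h] at this; simp at this
  · have : b ∈ (U \ {x, y}).filter (fun z => ¬ Rch Γ M a z) := by
      simp [hb, hbx, hby, hc]
    rw [h] at this; simp at this

lemma factA (hΓ : NoMin Γ) {U B : Finset W} {S : Set W} (hst : St Γ U B S) (hns : NS Γ U B)
    {b n1 n2 n3 : W} (hb : b ∈ B) (h1 : n1 ∈ B) (h2 : n2 ∈ B) (h3 : n3 ∈ B)
    (a1 : Γ.Adj b n1) (a2 : Γ.Adj b n2) (a3 : Γ.Adj b n3)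
    (h12 : n1 ≠ n2) (h13 : n1 ≠ n3) (h23 : n2 ≠ n3) : False := by
  have e1 := a1.ne; have e2 := a2.ne; have e3 := a3.ne
  have hbU := hst.sub hb; have hU1 := hst.sub h1; have hU2 := hst.sub h2; have hU3 := hst.sub h3
  set M : Set W := {z | z ∈ U ∧ z ≠ b ∧ z ≠ n1 ∧ z ≠ n2 ∧ z ≠ n3} with hM
  have r12 := hns.rch hb h3 a3 hU1 e1.symm h13 hU2 e2.symm h23
  have r23 := hns.rch hb h1 a1 hU2 e2.symm h12.symm hU3 e3.symm h13.symm
  have r31 := hns.rch hb h2 a2 hU3 e3.symm h23.symm hU1 e1.symm h12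
  obtain ⟨K12, s12, c12, j12, d12⟩ := link (M := M) (by
    intro z hz; simp only [hM, mem_union, mem_ofPred_eq, mem_insert_iff, mem_singleton_iff] at hz ⊢; tauto) r12 h12
  obtain ⟨K23, s23, c23, j23, d23⟩ := link (M := M) (by
    intro z hz; simp only [hM, mem_union, mem_ofPred_eq, mem_insert_iff, mem_singleton_iff] at hz ⊢; tauto) r23 h23
  obtain ⟨K31, s31, c31, j31, d31⟩ := link (M := M) (by
    intro z hz; simp only [hM, mem_union, mem_ofPred_eq, mem_insert_iff, mem_singleton_iff] at hz ⊢; tauto) r31 h13.symm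
  have hS : ∀ x ∈ B, SAdj Γ S {x} := fun x hx => by
    obtain ⟨s, hs, h⟩ := hst.hub x hx
    exact ⟨s, hs, x, rfl, h⟩
  have dS : ∀ X : Set W, (∀ x ∈ X, x ∈ U) → Disjoint S X := fun X hX =>
    Set.disjoint_left.2 fun x hx hx' => hst.disj x (hX x hx') hx
  have dSs : ∀ x ∈ U, Disjoint S {x} := fun x hx => dS _ (by rintro y rfl; exact hx)
  -- no full component
  have full : ∀ y ∈ M, SAdj Γ {x | Rch Γ M y x} {n1} → SAdj Γ {x | Rch Γ M y x} {n2} →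
      SAdj Γ {x | Rch Γ M y x} {n3} → False := by
    intro y hy f1 f2 f3
    have hK : ∀ x ∈ {x | Rch Γ M y x}, x ∈ M := fun x hx => Rch.mem hx hy
    refine noK33 hΓ S {b} {x | Rch Γ M y x} {n1} {n2} {n3} hst.conn (conn_singleton _)
      (conn_comp _ _) (conn_singleton _) (conn_singleton _) (conn_singleton _)
      (dSs b hbU) (dS _ fun x hx => (hK x hx).1) (dSs _ hU1) (dSs _ hU2) (dSs _ hU3)
      ?_ ?_ ?_ ?_ ?_ ?_ ?_ ?_ ?_ ?_ (hS _ h1) (hS _ h2) (hS _ h3)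
      ⟨b, rfl, n1, rfl, a1⟩ ⟨b, rfl, n2, rfl, a2⟩ ⟨b, rfl, n3, rfl, a3⟩ f1 f2 f3
    · rw [Set.disjoint_singleton_left]; exact fun h => (hK _ h).2.1 rfl
    · simpa using e1
    · simpa using e2
    · simpa using e3
    · rw [Set.disjoint_singleton_right]; exact fun h => (hK _ h).2.2.1 rfl
    · rw [Set.disjoint_singleton_right]; exact fun h => (hK _ h).2.2.2.1 rfl
    · rw [Set.disjoint_singleton_right]; exact fun h => (hK _ h).2.2.2.2 rfl
    · simpa using h12
    · simpa using h13
    · simpa using h23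
  have djK : ∀ {K K' : Set W} {p q r s : W},
      (K = ∅ ∨ ∃ y ∈ M, K = {x | Rch Γ M y x} ∧ SAdj Γ K {p} ∧ SAdj Γ K {q}) →
      (K' = ∅ ∨ ∃ y ∈ M, K' = {x | Rch Γ M y x} ∧ SAdj Γ K' {r} ∧ SAdj Γ K' {s}) →
      (∀ X : Set W, SAdj Γ X {p} → SAdj Γ X {q} → SAdj Γ X {r} → SAdj Γ X {s} →
        SAdj Γ X {n1} ∧ SAdj Γ X {n2} ∧ SAdj Γ X {n3}) → Disjoint K K' := by
    intro K K' p q r s hK hK' hX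
    rcases hK with rfl | ⟨y, hy, rfl, k1, k2⟩
    · simp
    rcases hK' with rfl | ⟨z, hz, rfl, k3, k4⟩
    · simp
    rw [Set.disjoint_left]
    intro x hx hx'
    have := comp_eq hy hz hx hx'
    rw [← this] at k3 k4
    obtain ⟨f1, f2, f3⟩ := hX _ k1 k2 k3 k4
    exact full y hy f1 f2 f3
  have D1 : Disjoint K12 K23 := djK d12 d23 (fun X h1 h2 h3 h4 => ⟨h1, h2, h4⟩)
  have D2 : Disjoint K12 K31 := djK d12 d31 (fun X h1 h2 h3 h4 => ⟨h1, h2, h3⟩)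
  have D3 : Disjoint K23 K31 := djK d23 d31 (fun X h1 h2 h3 h4 => ⟨h4, h1, h2⟩)
  have sub : ∀ {n : W} {K : Set W}, n ∈ U → K ⊆ M → ∀ x ∈ ({n} ∪ K : Set W), x ∈ U := by
    intro n K hn hK x hx
    rcases hx with rfl | hx
    · exact hn
    · exact (hK hx).1
  have nb : ∀ {n : W} {K : Set W}, b ≠ n → K ⊆ M → Disjoint ({b} : Set W) ({n} ∪ K) := by
    intro n K hn hK
    rw [Set.disjoint_singleton_left]
    rintro (h | h)
    · exact hn h
    · exact (hK h).2.1 rfl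
  have dd : ∀ {p q : W} {K K' : Set W}, p ≠ q → K ⊆ M → K' ⊆ M → Disjoint K K' → p ∉ M → q ∉ M →
      Disjoint ({p} ∪ K : Set W) ({q} ∪ K') := by
    intro p q K K' hpq hK hK' hd hp hq
    rw [Set.disjoint_left]
    rintro x (rfl | hx) (hx' | hx')
    · exact hpq hx'
    · exact hp (hK' hx')
    · rw [mem_singleton_iff] at hx'; subst hx'; exact hq (hK hx)
    · exact (Set.disjoint_left.1 hd) hx hx'
  have m1 : n1 ∉ M := fun h => h.2.2.1 rfl
  have m2 : n2 ∉ M := fun h => h.2.2.2.1 rfl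
  have m3 : n3 ∉ M := fun h => h.2.2.2.2 rfl
  have up : ∀ {X : Set W} {n : W} {K : Set W}, SAdj Γ X {n} → SAdj Γ X ({n} ∪ K) := by
    rintro X n K ⟨a, ha, c, hc, h⟩
    exact ⟨a, ha, c, Or.inl hc, h⟩
  have sy : ∀ {X Y : Set W}, SAdj Γ X Y → SAdj Γ Y X := by
    rintro X Y ⟨a, ha, c, hc, h⟩
    exact ⟨c, hc, a, ha, h.symm⟩
  refine noK5 hΓ S {b} ({n1} ∪ K12) ({n2} ∪ K23) ({n3} ∪ K31) hst.conn (conn_singleton _) c12 c23 c31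
    (dSs b hbU) (dS _ (sub hU1 s12)) (dS _ (sub hU2 s23)) (dS _ (sub hU3 s31))
    (nb e1 s12) (nb e2 s23) (nb e3 s31) (dd h12 s12 s23 D1 m1 m2) (dd h13 s12 s31 D2 m1 m3)
    (dd h23 s23 s31 D3 m2 m3) (hS _ hb) (up (hS _ h1)) (up (hS _ h2)) (up (hS _ h3))
    (up ⟨b, rfl, n1, rfl, a1⟩) (up ⟨b, rfl, n2, rfl, a2⟩) (up ⟨b, rfl, n3, rfl, a3⟩)
    (up j12) (sy (up j31)) (up j23)

lemma factB (hΓ : NoMin Γ) {U B : Finset W} {S : Set W} (hst : St Γ U B S) (hns : NS Γ U B)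
    {x y z u : W} (hx : x ∈ B) (hy : y ∈ B) (hz : z ∈ B) (hu : u ∈ B)
    (axy : Γ.Adj x y) (axz : Γ.Adj x z) (ayz : Γ.Adj y z)
    (hux : u ≠ x) (huy : u ≠ y) (huz : u ≠ z) : False := by
  have hUx := hst.sub hx; have hUy := hst.sub hy; have hUz := hst.sub hz; have hUu := hst.sub hu
  set M : Set W := {t | t ∈ U ∧ t ≠ x ∧ t ≠ y ∧ t ≠ z} with hM
  have huM : u ∈ M := ⟨hUu, hux, huy, huz⟩
  have aux : ∀ n : W, n ∉ M → ∀ N : Set W, N ⊆ M ∪ {n} → Rch Γ N u n →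
      SAdj Γ {t | Rch Γ M u t} {n} := by
    intro n hn N hN h
    have : ∀ t, Rch Γ N u t → SAdj Γ {t | Rch Γ M u t} {n} ∨ Rch Γ M u t := by
      intro t ht
      induction ht with
      | refl => exact Or.inr .refl
      | @tail b c h1 h2 ih =>
        rcases ih with ih | ih
        · exact Or.inl ih
        · rcases hN h2.2 with hc | hc
          · exact Or.inr (Relation.ReflTransGen.tail ih ⟨h2.1, hc⟩)
          · exact Or.inl ⟨b, ih, c, hc, h2.1⟩
    rcases this n h with h | h
    · exact h
    · exact absurd (Rch.mem h huM) hn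
  have sx := aux x (fun h => h.2.1 rfl) _ (by
    intro t ht; simp only [hM, mem_union, mem_ofPred_eq, mem_singleton_iff] at ht ⊢; tauto)
    (hns.rch hy hz ayz hUu huy huz hUx axy.ne axz.ne)
  have sy := aux y (fun h => h.2.2.1 rfl) _ (by
    intro t ht; simp only [hM, mem_union, mem_ofPred_eq, mem_singleton_iff] at ht ⊢; tauto)
    (hns.rch hx hz axz hUu hux huz hUy axy.ne.symm ayz.ne)
  have sz := aux z (fun h => h.2.2.2 rfl) _ (by
    intro t ht; simp only [hM, mem_union, mem_ofPred_eq, mem_singleton_iff] at ht ⊢; tauto)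
    (hns.rch hx hy axy hUu hux huy hUz axz.ne.symm ayz.ne.symm)
  have hS : ∀ x ∈ B, SAdj Γ S {x} := fun x hx => by
    obtain ⟨s, hs, h⟩ := hst.hub x hx
    exact ⟨s, hs, x, rfl, h⟩
  have dSs : ∀ x ∈ U, Disjoint S {x} := fun x hx => by
    rw [Set.disjoint_singleton_right]; exact hst.disj x hx
  have hK : ∀ t ∈ {t | Rch Γ M u t}, t ∈ M := fun t ht => Rch.mem ht huM
  refine noK5 hΓ S {t | Rch Γ M u t} {x} {y} {z} hst.conn (conn_comp _ _) (conn_singleton _)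
    (conn_singleton _) (conn_singleton _)
    (Set.disjoint_left.2 fun t ht ht' => hst.disj t (hK t ht').1 ht)
    (dSs _ hUx) (dSs _ hUy) (dSs _ hUz) ?_ ?_ ?_ ?_ ?_ ?_ ?_ (hS _ hx) (hS _ hy) (hS _ hz) sx sy sz
    ⟨x, rfl, y, rfl, axy⟩ ⟨x, rfl, z, rfl, axz⟩ ⟨y, rfl, z, rfl, ayz⟩
  · rw [Set.disjoint_singleton_right]; exact fun h => (hK _ h).2.1 rfl
  · rw [Set.disjoint_singleton_right]; exact fun h => (hK _ h).2.2.1 rfl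
  · rw [Set.disjoint_singleton_right]; exact fun h => (hK _ h).2.2.2 rfl
  · simpa using axy.ne
  · simpa using axz.ne
  · simpa using ayz.ne
  · obtain ⟨s, hs, h⟩ := hst.hub u hu
    exact ⟨s, hs, u, .refl, h⟩

end comb
end TL

namespace TL

section col
open scoped Classical
variable {W : Type} {Γ : SimpleGraph W}

/-- `φ` is a proper list colouring of the part of `Γ` on `U` -/
def Col (Γ : SimpleGraph W) (U : Finset W) (L : W → Finset ℕ) (φ : W → ℕ) : Prop :=
  (∀ v ∈ U, φ v ∈ L v) ∧ ∀ u ∈ U, ∀ v ∈ U, Γ.Adj u v → φ u ≠ φ v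

/-- a state with lists -/
structure Inst (Γ : SimpleGraph W) (U B : Finset W) (S : Set W) (L : W → Finset ℕ) : Prop
    extends St Γ U B S where
  l3 : ∀ v ∈ B, 3 ≤ (L v).card
  l5 : ∀ v ∈ U, v ∉ B → 5 ≤ (L v).card

/-- boundary after deleting `P` -/
noncomputable def dB (Γ : SimpleGraph W) (U B P : Finset W) : Finset W :=
  (U \ P).filter (fun v => v ∈ B ∨ ∃ p ∈ P, Γ.Adj p v)

/-- lists after deleting `P`, with the colours in `D` reserved -/
noncomputable def dL (Γ : SimpleGraph W) (B P : Finset W) (D : Finset ℕ) (L : W → Finset ℕ) :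
    W → Finset ℕ :=
  fun v => if v ∈ B then L v else if ∃ p ∈ P, Γ.Adj p v then L v \ D else L v

lemma mem_dB {U B P : Finset W} {v : W} :
    v ∈ dB Γ U B P ↔ (v ∈ U ∧ v ∉ P) ∧ (v ∈ B ∨ ∃ p ∈ P, Γ.Adj p v) := by
  simp [dB]

lemma dL_mem {B P : Finset W} {D : Finset ℕ} {L : W → Finset ℕ} {v : W} (h : v ∈ B) :
    dL Γ B P D L v = L v := by
  simp [dL, h]

lemma dL_sub {B P : Finset W} {D : Finset ℕ} {L : W → Finset ℕ} {v : W} :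
    dL Γ B P D L v ⊆ L v := by
  unfold dL
  split_ifs
  · exact subset_rfl
  · exact Finset.sdiff_subset
  · exact subset_rfl

lemma card_dL {B P : Finset W} {D : Finset ℕ} {L : W → Finset ℕ} {v : W} :
    (L v).card ≤ (dL Γ B P D L v).card + D.card := by
  unfold dL
  split_ifs
  · omega
  · have := Finset.card_le_card_sdiff_add_card (s := L v) (t := D)
    omega
  · omega

lemma Inst.del_aux {U B : Finset W} {S S' : Set W} {L : W → Finset ℕ} (h : Inst Γ U B S L)
    {P : Finset W} {D : Finset ℕ} (hD : D.card ≤ 2) (hS : Conn Γ S')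
    (hS1 : ∀ x ∈ U, x ∉ P → x ∉ S') (hPS : ∀ p ∈ P, p ∈ S')
    (hB : ∀ b ∈ B, ∃ s ∈ S', Γ.Adj s b) :
    Inst Γ (U \ P) (dB Γ U B P) S' (dL Γ B P D L) where
  sub := Finset.filter_subset _ _
  conn := hS
  disj := fun x hx => by
    rw [Finset.mem_sdiff] at hx; exact hS1 x hx.1 hx.2
  hub := fun b hb => by
    rw [mem_dB] at hb
    rcases hb.2 with h | ⟨p, hp, h⟩
    · exact hB b h
    · exact ⟨p, hPS p hp, h⟩
  l3 := fun v hv => by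
    rw [mem_dB] at hv
    by_cases hB : v ∈ B
    · rw [dL_mem hB]; exact h.l3 v hB
    · have := h.l5 v hv.1.1 hB
      have := card_dL (Γ := Γ) (B := B) (P := P) (D := D) (L := L) (v := v)
      omega
  l5 := fun v hv hv' => by
    rw [Finset.mem_sdiff] at hv
    rw [mem_dB] at hv'
    push Not at hv'
    obtain ⟨h1, h2⟩ := hv' hv
    have : dL Γ B P D L v = L v := by
      unfold dL
      rw [if_neg h1, if_neg]
      push Not; exact h2
    rw [this]
    exact h.l5 v hv.1 h1

lemma Inst.del {U B : Finset W} {S : Set W} {L : W → Finset ℕ} (h : Inst Γ U B S L)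
    {P : Finset W} (hP : P ⊆ B) {D : Finset ℕ} (hD : D.card ≤ 2) :
    Inst Γ (U \ P) (dB Γ U B P) (S ∪ ↑P) (dL Γ B P D L) := by
  refine h.del_aux hD (h.conn.union_attached _ fun p hp => h.hub p (hP hp)) ?_ ?_ ?_
  · rintro x hx hx' (h' | h')
    · exact h.disj x hx h'
    · exact hx' h'
  · exact fun p hp => Or.inr hp
  · intro b hb
    obtain ⟨s, hs, h'⟩ := h.hub b hb
    exact ⟨s, Or.inl hs, h'⟩

lemma combine {U B P : Finset W} {D : Finset ℕ} {L : W → Finset ℕ} {φ κ : W → ℕ}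
    (hc : Col Γ (U \ P) (dL Γ B P D L) φ) (h1 : ∀ p ∈ P, κ p ∈ L p) (h2 : ∀ p ∈ P, κ p ∈ D)
    (h3 : ∀ p ∈ P, ∀ q ∈ P, Γ.Adj p q → κ p ≠ κ q)
    (h4 : ∀ p ∈ P, ∀ n ∈ B, n ∉ P → Γ.Adj p n → κ p ≠ φ n) :
    Col Γ U L (fun v => if v ∈ P then κ v else φ v) := by
  have key : ∀ p ∈ P, ∀ n ∈ U, n ∉ P → Γ.Adj p n → κ p ≠ φ n := by
    intro p hp n hn hnP ha
    by_cases hB : n ∈ B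
    · exact h4 p hp n hB hnP ha
    · intro he
      have := hc.1 n (Finset.mem_sdiff.2 ⟨hn, hnP⟩)
      have e : dL Γ B P D L n = L n \ D := by
        unfold dL
        rw [if_neg hB, if_pos ⟨p, hp, ha⟩]
      rw [e, ← he] at this
      exact (Finset.mem_sdiff.1 this).2 (h2 p hp)
  constructor
  · intro v hv
    by_cases h : v ∈ P
    · simp only [h, if_true]; exact h1 v h
    · simp only [h, if_false]; exact dL_sub (hc.1 v (Finset.mem_sdiff.2 ⟨hv, h⟩))
  · intro u hu v hv ha
    by_cases hP : u ∈ P <;> by_cases hP' : v ∈ P <;> simp only [hP, hP', if_true, if_false]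
    · exact h3 u hP v hP' ha
    · exact key u hP v hv hP' ha
    · exact (key v hP' u hu hP ha.symm).symm
    · exact hc.2 u (Finset.mem_sdiff.2 ⟨hu, hP⟩) v (Finset.mem_sdiff.2 ⟨hv, hP'⟩) ha

/-- splitting along an edge -/
structure Sp (Γ : SimpleGraph W) (U U1 U2 : Finset W) (x y : W) : Prop where
  un : ∀ v, v ∈ U ↔ v ∈ U1 ∨ v ∈ U2
  int : ∀ v, v ∈ U1 → v ∈ U2 → v = x ∨ v = y
  x1 : x ∈ U1
  x2 : x ∈ U2
  y1 : y ∈ U1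
  y2 : y ∈ U2
  na : ∀ a ∈ U1, a ∉ U2 → ∀ b ∈ U2, b ∉ U1 → ¬ Γ.Adj a b
  c1 : U1.card < U.card
  c2 : U2.card < U.card

lemma Sp.symm {U U1 U2 : Finset W} {x y : W} (h : Sp Γ U U1 U2 x y) : Sp Γ U U2 U1 x y where
  un := fun v => by rw [h.un v, or_comm]
  int := fun v h1 h2 => h.int v h2 h1
  x1 := h.x2
  x2 := h.x1
  y1 := h.y2
  y2 := h.y1
  na := fun a h1 h2 b h3 h4 h5 => h.na b h3 h4 a h1 h2 h5.symm
  c1 := h.c2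
  c2 := h.c1

lemma exists_sp {U B : Finset W} (hB : B ⊆ U) (h : ¬ NS Γ U B) :
    ∃ x ∈ B, ∃ y ∈ B, Γ.Adj x y ∧ ∃ U1 U2, Sp Γ U U1 U2 x y := by
  unfold NS at h
  push Not at h
  obtain ⟨x, hx, y, hy, hxy, K1, K2, hu, hd, hn, h1, h2⟩ := h
  have hm : ∀ v, (v ∈ K1 ∨ v ∈ K2) ↔ v ∈ U ∧ v ≠ x ∧ v ≠ y := by
    intro v
    have := Finset.ext_iff.1 hu v
    simpa [not_or] using this
  have hdd : ∀ v, v ∈ K1 → v ∉ K2 := fun v h h' => Finset.disjoint_left.1 hd h h'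
  refine ⟨x, hx, y, hy, hxy, insert x (insert y K1), insert x (insert y K2), ?_⟩
  have hxU := hB hx
  have hyU := hB hy
  obtain ⟨k1, hk1⟩ := h1
  obtain ⟨k2, hk2⟩ := h2
  refine ⟨?_, ?_, by simp, by simp, by simp, by simp, ?_, ?_, ?_⟩
  · intro v
    have := hm v
    simp only [Finset.mem_insert]
    by_cases h1 : v = x
    · subst h1; simp [hxU]
    by_cases h2 : v = y
    · subst h2; simp [hyU]
    tauto
  · intro v h1 h2
    simp only [Finset.mem_insert] at h1 h2
    have := hdd v
    tauto
  · intro a ha ha' b hb hb'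
    simp only [Finset.mem_insert, not_or] at ha ha' hb hb'
    exact hn a (by tauto) b (by tauto)
  · apply Finset.card_lt_card
    refine ⟨?_, fun h => ?_⟩
    · intro v hv
      have := hm v
      simp only [Finset.mem_insert] at hv
      rcases hv with rfl | rfl | hv
      · exact hxU
      · exact hyU
      · tauto
    · have h3 := (hm k2).1 (Or.inr hk2)
      have h4 := h h3.1
      have h5 := hdd k2
      simp only [Finset.mem_insert] at h4
      tauto
  · apply Finset.card_lt_card
    refine ⟨?_, fun h => ?_⟩
    · intro v hv
      have := hm v
      simp only [Finset.mem_insert] at hv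
      rcases hv with rfl | rfl | hv
      · exact hxU
      · exact hyU
      · tauto
    · have h3 := (hm k1).1 (Or.inl hk1)
      have h4 := h h3.1
      have h5 := hdd k1
      simp only [Finset.mem_insert] at h4
      tauto

lemma Sp.clique {U U1 U2 : Finset W} {x y : W} (h : Sp Γ U U1 U2 x y) {a b : W}
    (ha : a ∈ U) (hb : b ∈ U) (hab : Γ.Adj a b) : (a ∈ U1 ∧ b ∈ U1) ∨ (a ∈ U2 ∧ b ∈ U2) := by
  have h1 := (h.un a).1 ha
  have h2 := (h.un b).1 hb
  have h3 := h.na a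
  have h4 := h.na b
  have h5 := hab.symm
  by_contra hc
  by_cases a1 : a ∈ U1 <;> by_cases a2 : a ∈ U2 <;> by_cases b1 : b ∈ U1 <;>
    by_cases b2 : b ∈ U2 <;> simp_all

lemma Sp.glue {U U1 U2 : Finset W} {x y : W} (h : Sp Γ U U1 U2 x y) {L : W → Finset ℕ}
    {φ1 φ2 : W → ℕ} (h1 : Col Γ U1 L φ1) (h2 : Col Γ U2 L φ2) (hx : φ1 x = φ2 x)
    (hy : φ1 y = φ2 y) : ∃ φ, Col Γ U L φ ∧ (∀ v ∈ U1, φ v = φ1 v) ∧ ∀ v ∈ U2, φ v = φ2 v := by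
  obtain ⟨F, hF⟩ : ∃ F : W → ℕ, ∀ v, F v = if v ∈ U1 then φ1 v else φ2 v := ⟨_, fun _ => rfl⟩
  have e1 : ∀ v ∈ U1, F v = φ1 v := by
    intro v hv; simp [hF, hv]
  have e2 : ∀ v ∈ U2, F v = φ2 v := by
    intro v hv
    by_cases h' : v ∈ U1
    · simp only [hF, h', if_true]
      rcases h.int v h' hv with rfl | rfl <;> assumption
    · simp [hF, h']
  refine ⟨F, ⟨?_, ?_⟩, e1, e2⟩
  · intro v hv
    rcases (h.un v).1 hv with h' | h'
    · rw [e1 v h']; exact h1.1 v h'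
    · rw [e2 v h']; exact h2.1 v h'
  · intro a ha b hb hab
    rcases h.clique ha hb hab with ⟨ha, hb⟩ | ⟨ha, hb⟩
    · rw [e1 a ha, e1 b hb]; exact h1.2 a ha b hb hab
    · rw [e2 a ha, e2 b hb]; exact h2.2 a ha b hb hab

lemma Inst.restrict {U B : Finset W} {S : Set W} {L : W → Finset ℕ} (h : Inst Γ U B S L)
    {U1 : Finset W} (h1 : ∀ v ∈ U1, v ∈ U) : Inst Γ U1 (B.filter (· ∈ U1)) S L where
  sub := fun v hv => (Finset.mem_filter.1 hv).2
  conn := h.conn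
  disj := fun x hx => h.disj x (h1 x hx)
  hub := fun b hb => h.hub b (Finset.mem_filter.1 hb).1
  l3 := fun v hv => h.l3 v (Finset.mem_filter.1 hv).1
  l5 := fun v hv hv' => h.l5 v (h1 v hv) fun hB => hv' (Finset.mem_filter.2 ⟨hB, hv⟩)

lemma exists_avoid1 {s : Finset ℕ} (h : 2 ≤ s.card) (a : ℕ) : ∃ c ∈ s, c ≠ a := by
  by_contra hc
  push Not at hc
  have : s ⊆ {a} := fun c hc' => by simp [hc c hc']
  have := Finset.card_le_card this
  simp at this; omega

lemma exists_avoid2 {s : Finset ℕ} (h : 3 ≤ s.card) (a b : ℕ) : ∃ c ∈ s, c ≠ a ∧ c ≠ b := by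
  by_contra hc
  push Not at hc
  have : s ⊆ {a, b} := fun c hc' => by
    simp only [Finset.mem_insert, Finset.mem_singleton]
    by_cases h : c = a
    · exact Or.inl h
    · exact Or.inr (hc c hc' h)
  have := Finset.card_le_card this
  have := Finset.card_le_two (a := a) (b := b)
  omega

lemma exists_two {s : Finset ℕ} (h : 3 ≤ s.card) (p : ℕ) :
    ∃ a ∈ s, ∃ b ∈ s, a ≠ b ∧ a ≠ p ∧ b ≠ p := by
  obtain ⟨a, ha, hap⟩ := exists_avoid1 (s := s) (by omega) p
  obtain ⟨b, hb, hba, hbp⟩ := exists_avoid2 h a p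
  exact ⟨a, ha, b, hb, hba.symm, hap, hbp⟩

lemma card_sdiff_lt {U P : Finset W} {p : W} (hp : p ∈ P) (hpU : p ∈ U) :
    (U \ P).card < U.card := by
  apply Finset.card_lt_card
  refine ⟨Finset.sdiff_subset, fun h => ?_⟩
  exact (Finset.mem_sdiff.1 (h hpU)).2 hp

/-- Thomassen's theorem in the abstract setting -/
lemma thom_aux (hΓ : NoMin Γ) : ∀ n : ℕ, ∀ (U B : Finset W) (S : Set W) (L : W → Finset ℕ),
    Inst Γ U B S L → U.card ≤ n → 
    (∀ x ∈ B, ∀ y ∈ B, Γ.Adj x y → ∀ ψ : W → ℕ, ψ x ∈ L x → ψ y ∈ L y → ψ x ≠ ψ y →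
      ∃ φ, Col Γ U L φ ∧ φ x = ψ x ∧ φ y = ψ y) ∧
    (∀ x ∈ B, ∀ ψ : W → ℕ, ψ x ∈ L x → ∃ φ, Col Γ U L φ ∧ φ x = ψ x) ∧
    ∃ φ, Col Γ U L φ := by
  intro n
  induction n with
  | zero =>
    intro U B S L h hU
    have hU : U = ∅ := Finset.card_eq_zero.1 (by omega)
    subst hU
    have hB : B = ∅ := Finset.subset_empty.1 h.sub
    subst hB
    exact ⟨by simp, by simp, fun _ => 0, by simp [Col]⟩
  | succ n ih =>
    intro U B S L h hU
    have E2 : ∀ x ∈ B, ∀ y ∈ B, Γ.Adj x y → ∀ ψ : W → ℕ, ψ x ∈ L x → ψ y ∈ L y → ψ x ≠ ψ y →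
        ∃ φ, Col Γ U L φ ∧ φ x = ψ x ∧ φ y = ψ y := by
      intro x hx y hy hxy ψ px py pxy
      have hxU := h.sub hx
      have hyU := h.sub hy
      by_cases hns : NS Γ U B
      · by_cases hb : ∃ b ∈ B, Γ.Adj x b ∧ b ≠ y
        · obtain ⟨b, hb, hxb, hby⟩ := hb
          have hbU := h.sub hb
          by_cases hyb : Γ.Adj y b
          · -- triangle
            obtain ⟨c, hc, hcx, hcy⟩ := exists_avoid2 (h.l3 b hb) (ψ x) (ψ y)
            have hI := h.del (P := {x}) (by simpa using hx) (D := {ψ x}) (by simp)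
            have := card_sdiff_lt (U := U) (P := {x}) (p := x) (by simp) hxU
            obtain ⟨φ, hφ, h1, h2⟩ := (ih _ _ _ _ hI (by omega)).1 y
              (mem_dB.2 ⟨⟨hyU, by simpa using hxy.ne.symm⟩, Or.inl hy⟩) b
              (mem_dB.2 ⟨⟨hbU, by simpa using hxb.ne.symm⟩, Or.inl hb⟩) hyb
              (Function.update ψ b c) (by rw [dL_mem hy]; simpa [Function.update, hby.symm] using py)
              (by rw [dL_mem hb]; simpa using hc) (by simpa [Function.update, hby.symm] using hcy.symm)
            simp only [Function.update, hby.symm, dite_eq_ite, if_true] at h1 h2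
            refine ⟨_, combine (κ := ψ) hφ (by simpa using px) (by simp) ?_ ?_, by simp,
              by simp [hxy.ne.symm, h1]⟩
            · intro p hp q hq hpq
              rw [Finset.mem_singleton] at hp hq
              subst hp hq
              exact absurd hpq (Γ.loopless.irrefl _)
            · intro p hp m hm _ hpm
              rw [Finset.mem_singleton] at hp
              subst hp
              by_cases m1 : m = y
              · subst m1; rw [h1]; exact pxy
              by_cases m2 : m = b
              · subst m2; rw [h2]; exact hcx.symm
              exact (factA hΓ h.toSt hns hx hy hb hm hxy hxb hpm hby.symm (Ne.symm m1) (Ne.symm m2)).elim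
          · obtain ⟨c, hc, d, hd, hcd, hcx, hdx⟩ := exists_two (h.l3 b hb) (ψ x)
            have hI := h.del (P := {b}) (by simpa using hb) (D := {c, d}) Finset.card_le_two
            have := card_sdiff_lt (U := U) (P := {b}) (p := b) (by simp) hbU
            obtain ⟨φ, hφ, h1, h2⟩ := (ih _ _ _ _ hI (by omega)).1 x
              (mem_dB.2 ⟨⟨hxU, by simpa using hxb.ne⟩, Or.inl hx⟩) y
              (mem_dB.2 ⟨⟨hyU, by simpa using hby.symm⟩, Or.inl hy⟩) hxy ψ
              (by rw [dL_mem hx]; exact px) (by rw [dL_mem hy]; exact py) pxy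
            obtain ⟨e, he, hee⟩ : ∃ e ∈ ({c, d} : Finset ℕ), ∀ m ∈ B, Γ.Adj b m → e ≠ φ m := by
              have hxe : ∀ e ∈ ({c, d} : Finset ℕ), e ≠ φ x := by
                intro e he
                simp only [Finset.mem_insert, Finset.mem_singleton] at he
                rcases he with rfl | rfl
                · rw [h1]; exact hcx
                · rw [h1]; exact hdx
              by_cases hm : ∃ m ∈ B, Γ.Adj b m ∧ m ≠ x
              · obtain ⟨m, hm, hbm, hmx⟩ := hm
                obtain ⟨e, he, hem⟩ := exists_avoid1 (s := {c, d}) (by rw [Finset.card_pair hcd]) (φ m)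
                refine ⟨e, he, fun k hk hbk => ?_⟩
                by_cases k1 : k = x
                · subst k1; exact hxe e he
                by_cases k2 : k = m
                · subst k2; exact hem
                exact (factA hΓ h.toSt hns hb hx hm hk hxb.symm hbm hbk hmx.symm (Ne.symm k1) (Ne.symm k2)).elim
              · push Not at hm
                refine ⟨c, by simp, fun k hk hbk => ?_⟩
                rw [hm k hk hbk]; exact hxe c (by simp)
            have hcb : ∀ e ∈ ({c, d} : Finset ℕ), e ∈ L b := by
              intro e he
              simp only [Finset.mem_insert, Finset.mem_singleton] at he
              rcases he with rfl | rfl <;> assumption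
            refine ⟨_, combine (κ := fun _ => e) hφ (by simpa using hcb e he) (fun _ _ => he) ?_ ?_,
              by simp [hxb.ne, h1], by simp [hby.symm, h2]⟩
            · intro p hp q hq hpq
              rw [Finset.mem_singleton] at hp hq
              subst hp hq
              exact absurd hpq (Γ.loopless.irrefl _)
            · intro p hp m hm _ hpm
              rw [Finset.mem_singleton] at hp
              subst hp
              exact hee m hm hpm
        · push Not at hb
          have hI := h.del (P := {x}) (by simpa using hx) (D := {ψ x}) (by simp)
          have := card_sdiff_lt (U := U) (P := {x}) (p := x) (by simp) hxU
          obtain ⟨φ, hφ, h1⟩ := (ih _ _ _ _ hI (by omega)).2.1 y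
            (mem_dB.2 ⟨⟨hyU, by simpa using hxy.ne.symm⟩, Or.inl hy⟩) ψ
            (by rw [dL_mem hy]; exact py)
          refine ⟨_, combine (κ := ψ) hφ (by simpa using px) (by simp) ?_ ?_, by simp,
            by simp [hxy.ne.symm, h1]⟩
          · intro p hp q hq hpq
            rw [Finset.mem_singleton] at hp hq
            subst hp hq
            exact absurd hpq (Γ.loopless.irrefl _)
          · intro p hp m hm _ hpm
            rw [Finset.mem_singleton] at hp
            subst hp
            rw [hb m hm hpm, h1]; exact pxy
      · obtain ⟨s, hs, t, ht, hst, U1, U2, hsp⟩ := exists_sp h.sub hns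
        have main : ∀ U1 U2, Sp Γ U U1 U2 s t → x ∈ U1 → y ∈ U1 →
            ∃ φ, Col Γ U L φ ∧ φ x = ψ x ∧ φ y = ψ y := by
          intro U1 U2 hsp hx1 hy1
          have i1 := h.restrict (U1 := U1) (fun v hv => (hsp.un v).2 (Or.inl hv))
          have i2 := h.restrict (U1 := U2) (fun v hv => (hsp.un v).2 (Or.inr hv))
          have := hsp.c1
          have := hsp.c2
          obtain ⟨φ1, c1, e1, e2⟩ := (ih _ _ _ _ i1 (by omega)).1 x (Finset.mem_filter.2 ⟨hx, hx1⟩) y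
            (Finset.mem_filter.2 ⟨hy, hy1⟩) hxy ψ px py pxy
          obtain ⟨φ2, c2, e3, e4⟩ := (ih _ _ _ _ i2 (by omega)).1 s (Finset.mem_filter.2 ⟨hs, hsp.x2⟩) t
            (Finset.mem_filter.2 ⟨ht, hsp.y2⟩) hst φ1 (c1.1 s hsp.x1) (c1.1 t hsp.y1)
            (c1.2 s hsp.x1 t hsp.y1 hst)
          obtain ⟨φ, c, g1, g2⟩ := hsp.glue c1 c2 e3.symm e4.symm
          exact ⟨φ, c, by rw [g1 x hx1, e1], by rw [g1 y hy1, e2]⟩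
        rcases hsp.clique hxU hyU hxy with ⟨h1, h2⟩ | ⟨h1, h2⟩
        · exact main U1 U2 hsp h1 h2
        · exact main U2 U1 hsp.symm h1 h2
    have E1 : ∀ x ∈ B, ∀ ψ : W → ℕ, ψ x ∈ L x → ∃ φ, Col Γ U L φ ∧ φ x = ψ x := by
      intro x hx ψ px
      have hxU := h.sub hx
      by_cases hb : ∃ b ∈ B, Γ.Adj x b
      · obtain ⟨b, hb, hxb⟩ := hb
        obtain ⟨c, hc, hcx⟩ := exists_avoid1 (s := L b) (by have := h.l3 b hb; omega) (ψ x)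
        obtain ⟨φ, hφ, h1, -⟩ := E2 x hx b hb hxb (Function.update ψ b c)
          (by simpa [Function.update, hxb.ne] using px) (by simpa using hc)
          (by simpa [Function.update, hxb.ne] using hcx.symm)
        exact ⟨φ, hφ, by simpa [Function.update, hxb.ne] using h1⟩
      · push Not at hb
        have hI := h.del (P := {x}) (by simpa using hx) (D := {ψ x}) (by simp)
        have := card_sdiff_lt (U := U) (P := {x}) (p := x) (by simp) hxU
        obtain ⟨φ, hφ⟩ := (ih _ _ _ _ hI (by omega)).2.2
        refine ⟨_, combine (κ := ψ) hφ (by simpa using px) (by simp) ?_ ?_, by simp⟩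
        · intro p hp q hq hpq
          rw [Finset.mem_singleton] at hp hq
          subst hp hq
          exact absurd hpq (Γ.loopless.irrefl _)
        · intro p hp m hm _ hpm
          rw [Finset.mem_singleton] at hp
          subst hp
          exact absurd hpm (hb m hm)
    refine ⟨E2, E1, ?_⟩
    by_cases hB : B.Nonempty
    · obtain ⟨x, hx⟩ := hB
      have := h.l3 x hx
      obtain ⟨c, hc⟩ : (L x).Nonempty := Finset.card_pos.1 (by omega)
      obtain ⟨φ, hφ, -⟩ := E1 x hx (fun _ => c) hc
      exact ⟨φ, hφ⟩
    · rw [Finset.not_nonempty_iff_eq_empty] at hB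
      by_cases hU0 : U.Nonempty
      · obtain ⟨v, hv⟩ := hU0
        have := h.l5 v hv (by simp [hB])
        obtain ⟨c, hc⟩ : (L v).Nonempty := Finset.card_pos.1 (by omega)
        have hI := h.del_aux (P := {v}) (D := {c}) (S' := {v}) (by simp) (conn_singleton v)
          (fun x _ hx => by simpa using hx) (by simp) (by simp [hB])
        have := card_sdiff_lt (U := U) (P := {v}) (p := v) (by simp) hv
        obtain ⟨φ, hφ⟩ := (ih _ _ _ _ hI (by omega)).2.2
        refine ⟨_, combine (κ := fun _ => c) hφ (by simpa using hc) (by simp) ?_ ?_⟩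
        · intro p hp q hq hpq
          rw [Finset.mem_singleton] at hp hq
          subst hp hq
          exact absurd hpq (Γ.loopless.irrefl _)
        · simp [hB]
      · rw [Finset.not_nonempty_iff_eq_empty] at hU0
        exact ⟨fun _ => 0, by simp [Col, hU0]⟩

lemma thom (hΓ : NoMin Γ) {U B : Finset W} {S : Set W} {L : W → Finset ℕ} (h : Inst Γ U B S L)
    {x y : W} (hx : x ∈ B) (hy : y ∈ B) (hxy : Γ.Adj x y) (ψ : W → ℕ) (px : ψ x ∈ L x)
    (py : ψ y ∈ L y) (pxy : ψ x ≠ ψ y) : ∃ φ, Col Γ U L φ ∧ φ x = ψ x ∧ φ y = ψ y :=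
  (thom_aux hΓ _ U B S L h le_rfl).1 x hx y hy hxy ψ px py pxy

end col
end TL

namespace TL

section star
open scoped Classical
variable {W : Type} {Γ : SimpleGraph W}

/-- a constraint on colourings -/
inductive Src (W : Type) where
  | V (v : W) (p : ℕ)
  | E (x y : W) (p q : ℕ)

def Src.ok : Src W → (W → ℕ) → Prop
  | .V v p, φ => φ v ≠ p
  | .E x y p q, φ => ¬ (φ x = p ∧ φ y = q) ∧ ¬ (φ x = q ∧ φ y = p)

def Src.In (Γ : SimpleGraph W) (B : Finset W) : Src W → Prop
  | .V v _ => v ∈ B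
  | .E x y p q => x ∈ B ∧ y ∈ B ∧ Γ.Adj x y ∧ p ≠ q

def Src.On (u w : W) : Src W → Prop
  | .V v _ => v = u ∨ v = w
  | .E x y p q => ((x = u ∧ y = w) ∨ (x = w ∧ y = u)) ∧ p ≠ q

lemma Src.On.inn {u w : W} {σ : Src W} (h : σ.On u w) {B : Finset W} (hu : u ∈ B) (hw : w ∈ B)
    (ha : Γ.Adj u w) : σ.In Γ B := by
  cases σ with
  | V v p => rcases h with rfl | rfl <;> assumption
  | E x y p q =>
    obtain ⟨⟨rfl, rfl⟩ | ⟨rfl, rfl⟩, h⟩ := h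
    · exact ⟨hu, hw, ha, h⟩
    · exact ⟨hw, hu, ha.symm, h⟩

lemma Src.On.congr {u w : W} {σ : Src W} (h : σ.On u w) {φ ψ : W → ℕ} (hu : φ u = ψ u)
    (hw : φ w = ψ w) (ho : σ.ok φ) : σ.ok ψ := by
  cases σ with
  | V v p =>
    rcases h with rfl | rfl
    · simpa [Src.ok, hu] using ho
    · simpa [Src.ok, hw] using ho
  | E x y p q =>
    obtain ⟨⟨rfl, rfl⟩ | ⟨rfl, rfl⟩, -⟩ := h <;> simpa only [Src.ok, hu, hw] using ho

lemma Src.On.symm {u w : W} {σ : Src W} (h : σ.On u w) : σ.On w u := by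
  cases σ with
  | V v p => exact Or.symm h
  | E x y p q => exact ⟨Or.symm h.1, h.2⟩

/-- colourings of the edge `uw` satisfying some constraint extend to colourings satisfying `Q` -/
def Gd (Γ : SimpleGraph W) (U : Finset W) (L : W → Finset ℕ) (Q : (W → ℕ) → Prop) (u w : W) :
    Prop :=
  ∃ τ : Src W, τ.On u w ∧ ∀ ψ : W → ℕ, ψ u ∈ L u → ψ w ∈ L w → ψ u ≠ ψ w → τ.ok ψ →
    ∃ φ, Col Γ U L φ ∧ φ u = ψ u ∧ φ w = ψ w ∧ Q φ

lemma Gd.symm {U : Finset W} {L : W → Finset ℕ} {Q : (W → ℕ) → Prop} {u w : W}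
    (h : Gd Γ U L Q u w) : Gd Γ U L Q w u := by
  obtain ⟨τ, h1, h2⟩ := h
  refine ⟨τ, h1.symm, fun ψ a b c d => ?_⟩
  obtain ⟨φ, e1, e2, e3, e4⟩ := h2 ψ b a c.symm d
  exact ⟨φ, e1, e3, e2, e4⟩

lemma Gd.lift {U U' : Finset W} {L L' : W → Finset ℕ} {Q Q' : (W → ℕ) → Prop} {u w : W}
    (h : Gd Γ U' L' Q' u w) (hu : L' u = L u) (hw : L' w = L w)
    (H : ∀ φ', Col Γ U' L' φ' → Q' φ' → ∃ φ, Col Γ U L φ ∧ φ u = φ' u ∧ φ w = φ' w ∧ Q φ) :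
    Gd Γ U L Q u w := by
  obtain ⟨τ, h1, h2⟩ := h
  refine ⟨τ, h1, fun ψ a b c d => ?_⟩
  obtain ⟨φ', e1, e2, e3, e4⟩ := h2 ψ (by rwa [hu]) (by rwa [hw]) c d
  obtain ⟨φ, f1, f2, f3, f4⟩ := H φ' e1 e4
  exact ⟨φ, f1, by rw [f2, e2], by rw [f3, e3], f4⟩

lemma Gd.mono {U : Finset W} {L : W → Finset ℕ} {Q Q' : (W → ℕ) → Prop} {u w : W}
    (h : Gd Γ U L Q' u w) (H : ∀ φ, Col Γ U L φ → Q' φ → Q φ) : Gd Γ U L Q u w :=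
  h.lift rfl rfl fun φ h1 h2 => ⟨φ, h1, rfl, rfl, H φ h1 h2⟩

lemma Gd.thom (hΓ : NoMin Γ) {U B : Finset W} {S : Set W} {L : W → Finset ℕ} (h : Inst Γ U B S L)
    {u w : W} (hu : u ∈ B) (hw : w ∈ B) (huw : Γ.Adj u w) : Gd Γ U L (fun _ => True) u w := by
  refine ⟨.V u 0, Or.inl rfl, fun ψ a b c _ => ?_⟩
  obtain ⟨φ, h1, h2, h3⟩ := TL.thom hΓ h hu hw huw ψ a b c
  exact ⟨φ, h1, h2, h3, trivial⟩

/-- induction hypothesis -/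
def IH (Γ : SimpleGraph W) (n : ℕ) : Prop :=
  ∀ (U B : Finset W) (S : Set W) (L : W → Finset ℕ), Inst Γ U B S L → U.card < n →
    ∀ σ : Src W, σ.In Γ B → ∀ u ∈ B, ∀ w ∈ B, Γ.Adj u w → Gd Γ U L σ.ok u w

def pk (a b : ℕ) (t : Bool) : ℕ := if t then a else b

lemma pk_ne {a b : ℕ} (h : a ≠ b) {s t : Bool} (hst : s ≠ t) : pk a b s ≠ pk a b t := by
  cases s <;> cases t <;> simp_all [pk, Ne.symm h]

lemma pk_mem (a b : ℕ) (t : Bool) : pk a b t ∈ ({a, b} : Finset ℕ) := by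
  cases t <;> simp [pk]

/-- alternating sets -/
structure Alt (Γ : SimpleGraph W) (B : Finset W) (L : W → Finset ℕ) (Q : (W → ℕ) → Prop)
    (u w : W) (a b : ℕ) (P : Finset W) (κ : W → Bool) : Prop where
  sub : P ⊆ B
  hu : u ∉ P
  hw : w ∉ P
  ha : ∀ p ∈ P, a ∈ L p
  hb : ∀ p ∈ P, b ∈ L p
  prop : ∀ p ∈ P, ∀ q ∈ P, Γ.Adj p q → κ p ≠ κ q
  hQ : ∀ s : Bool, ∀ φ : W → ℕ, (∀ p ∈ P, φ p = pk a b (xor (κ p) s)) → Q φ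

lemma Alt.del {U B : Finset W} {L : W → Finset ℕ} {Q : (W → ℕ) → Prop}
    {u w : W} {a b : ℕ} (hab : a ≠ b) {P : Finset W} {κ : W → Bool}
    (h : Alt Γ B L Q u w a b P κ) {φ' : W → ℕ} (hc : Col Γ (U \ P) (dL Γ B P {a, b} L) φ')
    (s : Bool)
    (hs : ∀ p ∈ P, ∀ n ∈ B, n ∉ P → Γ.Adj p n → pk a b (xor (κ p) s) ≠ φ' n) :
    ∃ φ, Col Γ U L φ ∧ φ u = φ' u ∧ φ w = φ' w ∧ Q φ := by
  refine ⟨_, combine (κ := fun p => pk a b (xor (κ p) s)) hc ?_ ?_ ?_ hs, by simp [h.hu],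
    by simp [h.hw], ?_⟩
  · intro p hp
    have := pk_mem a b (xor (κ p) s)
    simp only [Finset.mem_insert, Finset.mem_singleton] at this
    rcases this with e | e <;> simp only [e]
    · exact h.ha p hp
    · exact h.hb p hp
  · intro p _; exact pk_mem a b _
  · intro p hp q hq hpq
    apply pk_ne hab
    have := h.prop p hp q hq hpq
    intro h; apply this
    simpa using h
  · exact h.hQ s _ fun p hp => by simp [hp]

lemma runOne (hΓ : NoMin Γ) {U B : Finset W} {S : Set W} {L : W → Finset ℕ} (h : Inst Γ U B S L)
    {u w : W} (hu : u ∈ B) (hw : w ∈ B) (huw : Γ.Adj u w)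
    {Q : (W → ℕ) → Prop} {a b : ℕ} (hab : a ≠ b) {P : Finset W} {κ : W → Bool}
    (hA : Alt Γ B L Q u w a b P κ) (p1 n1 : W)
    (h1 : ∀ p ∈ P, ∀ n ∈ B, n ∉ P → Γ.Adj p n → p = p1 ∧ n = n1) : Gd Γ U L Q u w := by
  have hI := h.del hA.sub (D := {a, b}) Finset.card_le_two
  refine (Gd.thom hΓ hI (mem_dB.2 ⟨⟨h.sub hu, hA.hu⟩, Or.inl hu⟩)
    (mem_dB.2 ⟨⟨h.sub hw, hA.hw⟩, Or.inl hw⟩) huw).lift (dL_mem hu) (dL_mem hw) ?_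
  intro φ' hc _
  by_cases hs : pk a b (xor (κ p1) true) = φ' n1
  · refine hA.del hab hc false fun p hp n hn hnP hpn => ?_
    obtain ⟨rfl, rfl⟩ := h1 p hp n hn hnP hpn
    rw [← hs]
    apply pk_ne hab
    simp
  · refine hA.del hab hc true fun p hp n hn hnP hpn => ?_
    obtain ⟨rfl, rfl⟩ := h1 p hp n hn hnP hpn
    exact hs

lemma run (hΓ : NoMin Γ) {U B : Finset W} {S : Set W} {L : W → Finset ℕ} (h : Inst Γ U B S L)
    (hns : NS Γ U B) (ih : IH Γ U.card)
    {u w : W} (hu : u ∈ B) (hw : w ∈ B) (huw : Γ.Adj u w)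
    {Q : (W → ℕ) → Prop} {a b : ℕ} (hab : a ≠ b) : ∀ (m : ℕ) (P : Finset W) (κ : W → Bool),
    (B \ P).card ≤ m → Alt Γ B L Q u w a b P κ → ∀ (p1 n1 p2 n2 : W), p1 ∈ P → p2 ∈ P →
    n1 ∈ B → n1 ∉ P → n2 ∈ B → n2 ∉ P → n1 ≠ n2 → Γ.Adj p1 n1 → Γ.Adj p2 n2 →
    (∀ p ∈ P, ∀ n ∈ B, n ∉ P → Γ.Adj p n → (p = p1 ∧ n = n1) ∨ (p = p2 ∧ n = n2)) →
    Gd Γ U L Q u w := by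
  intro m
  induction m with
  | zero =>
    intro P κ hm hA p1 n1 p2 n2 hp1 hp2 hn1 hn1' 
    have : n1 ∈ B \ P := Finset.mem_sdiff.2 ⟨hn1, hn1'⟩
    rw [Finset.card_eq_zero.1 (Nat.le_zero.1 hm)] at this
    simp at this
  | succ m ihm =>
    intro P κ hm hA p1 n1 p2 n2 hp1 hp2 hn1 hn1' hn2 hn2' hne a1 a2 hout
    have hI := h.del hA.sub (D := {a, b}) Finset.card_le_two
    have hlt := card_sdiff_lt (U := U) hp1 (h.sub (hA.sub hp1))
    have huB : u ∈ dB Γ U B P := mem_dB.2 ⟨⟨h.sub hu, hA.hu⟩, Or.inl hu⟩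
    have hwB : w ∈ dB Γ U B P := mem_dB.2 ⟨⟨h.sub hw, hA.hw⟩, Or.inl hw⟩
    by_cases hadj : Γ.Adj n1 n2
    · refine (ih _ _ _ _ hI hlt (.E n1 n2 a b) ⟨mem_dB.2 ⟨⟨h.sub hn1, hn1'⟩, Or.inl hn1⟩,
        mem_dB.2 ⟨⟨h.sub hn2, hn2'⟩, Or.inl hn2⟩, hadj, hab⟩ u huB w hwB huw).lift
        (dL_mem hu) (dL_mem hw) ?_
      intro φ' hc hok
      have hneq := hc.2 n1 (Finset.mem_sdiff.2 ⟨h.sub hn1, hn1'⟩) n2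
        (Finset.mem_sdiff.2 ⟨h.sub hn2, hn2'⟩) hadj
      obtain ⟨s, s1, s2⟩ : ∃ s : Bool, pk a b (xor (κ p1) s) ≠ φ' n1 ∧
          pk a b (xor (κ p2) s) ≠ φ' n2 := by
        by_contra hcon
        push Not at hcon
        have t1 := hcon true
        have t2 := hcon false
        simp only [Src.ok] at hok
        cases k1 : κ p1 <;> cases k2 : κ p2 <;> simp only [k1, k2, pk] at t1 t2 <;>
          simp at t1 t2 <;> grind
      refine hA.del hab hc s fun p hp n hn hnP hpn => ?_
      rcases hout p hp n hn hnP hpn with ⟨rfl, rfl⟩ | ⟨rfl, rfl⟩ <;> assumption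
    · have main : ∀ (p1 n1 p2 n2 : W), p1 ∈ P → p2 ∈ P →
          n1 ∈ B → n1 ∉ P → n2 ∈ B → n2 ∉ P → n1 ≠ n2 → Γ.Adj p1 n1 → Γ.Adj p2 n2 →
          (∀ p ∈ P, ∀ n ∈ B, n ∉ P → Γ.Adj p n → (p = p1 ∧ n = n1) ∨ (p = p2 ∧ n = n2)) →
          ¬ Γ.Adj n1 n2 → n1 ≠ u → n1 ≠ w → Gd Γ U L Q u w := by
        clear hadj hout a1 a2 hne hn2 hn2' hn1 hn1' hp1 hp2 p1 n1 p2 n2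
        intro p1 n1 p2 n2 hp1 hp2 hn1 hn1' hn2 hn2' hne a1 a2 hout hadj n1u n1w
        by_cases hs : ∃ s, pk a b (xor (κ p1) s) ∉ L n1
        · obtain ⟨s, hs⟩ := hs
          refine (ih _ _ _ _ hI hlt (.V n2 (pk a b (xor (κ p2) s)))
            (mem_dB.2 ⟨⟨h.sub hn2, hn2'⟩, Or.inl hn2⟩) u huB w hwB huw).lift
            (dL_mem hu) (dL_mem hw) ?_
          intro φ' hc hok
          refine hA.del hab hc s fun p hp n hn hnP hpn => ?_
          rcases hout p hp n hn hnP hpn with ⟨rfl, rfl⟩ | ⟨rfl, rfl⟩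
          · intro he
            apply hs
            rw [he]
            exact dL_sub (hc.1 n (Finset.mem_sdiff.2 ⟨h.sub hn, hnP⟩))
          · exact fun he => hok he.symm
        · push Not at hs
          have hL : a ∈ L n1 ∧ b ∈ L n1 := by
            have t1 := hs true
            have t2 := hs false
            cases k : κ p1 <;> simp [k, pk] at t1 t2 <;> exact ⟨by assumption, by assumption⟩
          have hnadj : ∀ p ∈ P, Γ.Adj p n1 → p = p1 := by
            intro p hp ha
            rcases hout p hp n1 hn1 hn1' ha with h | h
            · exact h.1
            · exact absurd h.2 hne
          have hA' : Alt Γ B L Q u w a b (insert n1 P) (Function.update κ n1 (!κ p1)) := by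
            have hk : ∀ p ∈ P, Function.update κ n1 (!κ p1) p = κ p := by
              intro p hp
              rw [Function.update_of_ne]
              rintro rfl; exact hn1' hp
            refine ⟨?_, ?_, ?_, ?_, ?_, ?_, ?_⟩
            · exact Finset.insert_subset hn1 hA.sub
            · simp [n1u.symm, hA.hu]
            · simp [n1w.symm, hA.hw]
            · intro p hp
              rcases Finset.mem_insert.1 hp with rfl | hp
              · exact hL.1
              · exact hA.ha p hp
            · intro p hp
              rcases Finset.mem_insert.1 hp with rfl | hp
              · exact hL.2
              · exact hA.hb p hp
            · intro p hp q hq hpq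
              rcases Finset.mem_insert.1 hp with rfl | hp' <;>
                rcases Finset.mem_insert.1 hq with rfl | hq'
              · exact absurd hpq (Γ.loopless.irrefl _)
              · have := hnadj q hq' hpq.symm
                subst this
                rw [hk q hq']; simp
              · have := hnadj p hp' hpq
                subst this
                rw [hk p hp']; simp
              · rw [hk p hp', hk q hq']; exact hA.prop p hp' q hq' hpq
            · intro s φ hφ
              refine hA.hQ s φ fun p hp => ?_
              rw [hφ p (Finset.mem_insert_of_mem hp), hk p hp]
          have hp1n : p1 ≠ n1 := a1.ne
          by_cases hx : ∃ n ∈ B, n ∉ insert n1 P ∧ Γ.Adj n1 n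
          · obtain ⟨n', hn', hn'P, hn'a⟩ := hx
            simp only [Finset.mem_insert, not_or] at hn'P
            refine ihm (insert n1 P) _ ?_ hA' n1 n' p2 n2 (by simp) (by simp [hp2]) hn'
              (by simp [hn'P]) hn2 (by simp [hn2', hne.symm]) ?_ hn'a a2 ?_
            · have : (B \ insert n1 P).card < (B \ P).card := by
                apply Finset.card_lt_card
                refine ⟨fun v hv => ?_, fun hh => ?_⟩
                · simp only [Finset.mem_sdiff, Finset.mem_insert, not_or] at hv ⊢
                  exact ⟨hv.1, hv.2.2⟩
                · have := hh (Finset.mem_sdiff.2 ⟨hn1, hn1'⟩)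
                  simp at this
              omega
            · rintro rfl; exact hadj hn'a
            · intro p hp n hn hnP hpn
              simp only [Finset.mem_insert, not_or] at hnP
              rcases Finset.mem_insert.1 hp with rfl | hp
              · left
                refine ⟨rfl, ?_⟩
                by_contra hcon
                exact factA hΓ h.toSt hns hn1 (hA.sub hp1) hn' hn a1.symm hn'a hpn
                  (fun e => hn'P.2 (e ▸ hp1)) (fun e => hnP.2 (e ▸ hp1)) (Ne.symm hcon)
              · rcases hout p hp n hn hnP.2 hpn with e | e
                · exact absurd e.2 hnP.1
                · exact Or.inr e
          · push Not at hx
            refine runOne hΓ h hu hw huw hab hA' p2 n2 ?_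
            intro p hp n hn hnP hpn
            rcases Finset.mem_insert.1 hp with rfl | hp
            · exact absurd hpn (hx n hn hnP)
            · simp only [Finset.mem_insert, not_or] at hnP
              rcases hout p hp n hn hnP.2 hpn with e | e
              · exact absurd e.2 hnP.1
              · exact e
      by_cases c1 : n1 ≠ u ∧ n1 ≠ w
      · exact main p1 n1 p2 n2 hp1 hp2 hn1 hn1' hn2 hn2' hne a1 a2 hout hadj c1.1 c1.2
      · have hc2 : n2 ≠ u ∧ n2 ≠ w := by
          refine ⟨?_, ?_⟩
          · rintro rfl
            have : n1 = w := by by_contra hh; exact c1 ⟨hne, hh⟩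
            subst this; exact hadj huw.symm
          · rintro rfl
            have : n1 = u := by by_contra hh; exact c1 ⟨hh, hne⟩
            subst this; exact hadj huw
        exact main p2 n2 p1 n1 hp2 hp1 hn2 hn2' hn1 hn1' hne.symm a2 a1
          (fun p hp n hn hnP hpn => (hout p hp n hn hnP hpn).symm) (fun e => hadj e.symm) hc2.1 hc2.2

lemma split_case (hΓ : NoMin Γ) {U B : Finset W} {S : Set W} {L : W → Finset ℕ}
    (h : Inst Γ U B S L) (ih : IH Γ U.card) {U1 U2 : Finset W} {x y : W} (hsp : Sp Γ U U1 U2 x y)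
    (hx : x ∈ B) (hy : y ∈ B) (hxy : Γ.Adj x y) {σ : Src W} 
    (hσ : σ.In Γ (B.filter (· ∈ U1))) {u w : W} (hu : u ∈ B) (hw : w ∈ B) (huw : Γ.Adj u w) :
    Gd Γ U L σ.ok u w := by
  have i1 := h.restrict (U1 := U1) (fun v hv => (hsp.un v).2 (Or.inl hv))
  have i2 := h.restrict (U1 := U2) (fun v hv => (hsp.un v).2 (Or.inr hv))
  have mf : ∀ {v : W} {U' : Finset W}, v ∈ B → v ∈ U' → v ∈ B.filter (· ∈ U') :=
    fun h1 h2 => Finset.mem_filter.2 ⟨h1, h2⟩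
  have hcong : ∀ φ φ' : W → ℕ, (∀ v ∈ U1, φ v = φ' v) → σ.ok φ' → σ.ok φ := by
    intro φ φ' hv hok
    cases σ with
    | V v p =>
      have := hv v (Finset.mem_filter.1 hσ).2
      simpa only [Src.ok, this] using hok
    | E s t p q =>
      have h1 := hv s (Finset.mem_filter.1 hσ.1).2
      have h2 := hv t (Finset.mem_filter.1 hσ.2.1).2
      simpa only [Src.ok, h1, h2] using hok
  rcases hsp.clique (h.sub hu) (h.sub hw) huw with ⟨u1, w1⟩ | ⟨u2, w2⟩
  · refine (ih _ _ _ _ i1 hsp.c1 σ hσ u (mf hu u1) w (mf hw w1) huw).lift rfl rfl ?_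
    intro φ1 c1 hok
    obtain ⟨φ2, c2, e1, e2⟩ := thom hΓ i2 (mf hx hsp.x2) (mf hy hsp.y2) hxy φ1 (c1.1 x hsp.x1)
      (c1.1 y hsp.y1) (c1.2 x hsp.x1 y hsp.y1 hxy)
    obtain ⟨φ, c, g1, g2⟩ := hsp.glue c1 c2 e1.symm e2.symm
    exact ⟨φ, c, g1 u u1, g1 w w1, hcong _ _ g1 hok⟩
  · obtain ⟨τ, ht, hτ⟩ := ih _ _ _ _ i1 hsp.c1 σ hσ x (mf hx hsp.x1) y (mf hy hsp.y1) hxy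
    refine (ih _ _ _ _ i2 hsp.c2 τ (ht.inn (mf hx hsp.x2) (mf hy hsp.y2) hxy) u (mf hu u2) w
      (mf hw w2) huw).lift rfl rfl ?_
    intro φ2 c2 hok
    obtain ⟨φ1, c1, e1, e2, hok1⟩ := hτ φ2 (c2.1 x hsp.x2) (c2.1 y hsp.y2)
      (c2.2 x hsp.x2 y hsp.y2 hxy) hok
    obtain ⟨φ, c, g1, g2⟩ := hsp.glue c1 c2 e1 e2
    exact ⟨φ, c, g2 u u2, g2 w w2, hcong _ _ g1 hok1⟩

lemma starV (hΓ : NoMin Γ) {U B : Finset W} {S : Set W} {L : W → Finset ℕ}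
    (h : Inst Γ U B S L) (ih : IH Γ U.card) (hns : NS Γ U B) {v : W} {p : ℕ} (hv : v ∈ B)
    {u w : W} (hu : u ∈ B) (hw : w ∈ B) (huw : Γ.Adj u w) :
    Gd Γ U L (Src.V v p).ok u w := by
  by_cases hon : (Src.V v p).On u w
  · refine ⟨.V v p, hon, fun ψ a b c d => ?_⟩
    obtain ⟨φ, h1, h2, h3⟩ := TL.thom hΓ h hu hw huw ψ a b c
    exact ⟨φ, h1, h2, h3, hon.congr h2.symm h3.symm d⟩
  simp only [Src.On, not_or] at hon
  obtain ⟨a, ha, b, hb, hab, hap, hbp⟩ := exists_two (h.l3 v hv) p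
  have hA : Alt Γ B L (Src.V v p).ok u w a b {v} (fun _ => true) := by
    refine ⟨by simpa using hv, by simpa using Ne.symm hon.1, by simpa using Ne.symm hon.2,
      by simpa using ha, by simpa using hb, ?_, ?_⟩
    · intro p hp q hq hpq
      rw [Finset.mem_singleton] at hp hq
      subst hp hq
      exact absurd hpq (Γ.loopless.irrefl _)
    · intro s φ hφ
      have := hφ v (by simp)
      simp only [Src.ok, this]
      cases s <;> simp [pk, hap, hbp]
  by_cases h1 : ∃ n1 ∈ B, Γ.Adj v n1
  · obtain ⟨n1, hn1, a1⟩ := h1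
    by_cases h2 : ∃ n2 ∈ B, Γ.Adj v n2 ∧ n2 ≠ n1
    · obtain ⟨n2, hn2, a2, hne⟩ := h2
      refine run hΓ h hns ih hu hw huw hab _ {v} _ le_rfl hA v n1 v n2 (by simp) (by simp) hn1
        (by simpa using a1.ne.symm) hn2 (by simpa using a2.ne.symm) hne.symm a1 a2 ?_
      intro p hp n hn hnP hpn
      rw [Finset.mem_singleton] at hp
      subst hp
      by_contra hcon
      push Not at hcon
      exact factA hΓ h.toSt hns hv hn1 hn2 hn a1 a2 hpn hne.symm (Ne.symm (hcon.1 rfl))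
        (Ne.symm (hcon.2 rfl))
    · push Not at h2
      refine runOne hΓ h hu hw huw hab hA v n1 ?_
      intro p hp n hn hnP hpn
      rw [Finset.mem_singleton] at hp
      subst hp
      exact ⟨rfl, h2 n hn hpn⟩
  · push Not at h1
    refine runOne hΓ h hu hw huw hab hA v v ?_
    intro p hp n hn hnP hpn
    rw [Finset.mem_singleton] at hp
    subst hp
    exact absurd hpn (h1 n hn)

end star
end TL

namespace TL

section starE
open scoped Classical
variable {W : Type} {Γ : SimpleGraph W}

lemma del1 {U B : Finset W} {L : W → Finset ℕ} {D : Finset ℕ} {x : W} {φ' : W → ℕ}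
    (hc : Col Γ (U \ {x}) (dL Γ B {x} D L) φ') {c : ℕ} (h1 : c ∈ L x) (h2 : c ∈ D)
    (h3 : ∀ n ∈ B, Γ.Adj x n → c ≠ φ' n) :
    ∃ φ, Col Γ U L φ ∧ φ x = c ∧ ∀ v, v ≠ x → φ v = φ' v := by
  refine ⟨_, combine (κ := fun _ => c) hc (by simpa using h1) (fun _ _ => h2) ?_ ?_, by simp, ?_⟩
  · intro p hp q hq hpq
    rw [Finset.mem_singleton] at hp hq
    subst hp hq
    exact absurd hpq (Γ.loopless.irrefl _)
  · intro p hp m hm _ hpm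
    rw [Finset.mem_singleton] at hp
    subst hp
    exact h3 m hm hpm
  · intro v hv; simp [hv]

lemma gdOther (hΓ : NoMin Γ) {U B : Finset W} {S : Set W} {L : W → Finset ℕ}
    (h : Inst Γ U B S L) (ih : IH Γ U.card) (hns : NS Γ U B) {x y : W} (hx : x ∈ B) (hy : y ∈ B)
    (hxy : Γ.Adj x y) (c : ℕ)
    {u w : W} (hu : u ∈ B) (hw : w ∈ B) (huw : Γ.Adj u w) (hxu : x ≠ u) (hxw : x ≠ w) :
    Gd Γ (U \ {x}) (dL Γ B {x} {c} L) (fun φ => ∀ n ∈ B, Γ.Adj x n → n ≠ y → φ n ≠ c) u w := by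
  have hI := h.del (P := {x}) (by simpa using hx) (D := {c}) (by simp)
  have hlt := card_sdiff_lt (U := U) (P := {x}) (p := x) (by simp) (h.sub hx)
  have huB : u ∈ dB Γ U B {x} := mem_dB.2 ⟨⟨h.sub hu, by simpa using hxu.symm⟩, Or.inl hu⟩
  have hwB : w ∈ dB Γ U B {x} := mem_dB.2 ⟨⟨h.sub hw, by simpa using hxw.symm⟩, Or.inl hw⟩
  by_cases hn : ∃ n ∈ B, Γ.Adj x n ∧ n ≠ y
  · obtain ⟨n, hn, hxn, hny⟩ := hn
    refine (ih _ _ _ _ hI hlt (.V n c) (mem_dB.2 ⟨⟨h.sub hn, by simpa using hxn.ne.symm⟩, Or.inl hn⟩)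
      u huB w hwB huw).mono ?_
    intro φ _ hok k hk hxk hky
    by_cases hkn : k = n
    · subst hkn; exact hok
    · exact (factA hΓ h.toSt hns hx hy hn hk hxy hxn hxk hny.symm (Ne.symm hky) (Ne.symm hkn)).elim
  · push Not at hn
    exact (Gd.thom hΓ hI huB hwB huw).mono fun φ _ _ k hk hxk hky => absurd (hn k hk hxk) hky

lemma starE_shared (hΓ : NoMin Γ) {U B : Finset W} {S : Set W} {L : W → Finset ℕ}
    (h : Inst Γ U B S L) (ih : IH Γ U.card) (hns : NS Γ U B) {x : W} {a b : ℕ} (hx : x ∈ B)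
    (hab : a ≠ b) (ha : a ∈ L x) (hb : b ∈ L x)
    {u w : W} (hu : u ∈ B) (hw : w ∈ B) (huw : Γ.Adj u w) (hxu : x ≠ u) (hxw : Γ.Adj x w) :
    Gd Γ U L (Src.E x w a b).ok u w := by
  obtain ⟨c, hc, hca, hcb⟩ := exists_avoid2 (h.l3 x hx) a b
  obtain ⟨τ, ht, hτ⟩ := gdOther hΓ h ih hns hx hw hxw c hu hw huw hxu hxw.ne
  refine ⟨τ, ht, fun ψ pu pw pne hok => ?_⟩
  by_cases hwc : ψ w = c
  · have hI := h.del (P := {x}) (by simpa using hx) (D := {a, b}) Finset.card_le_two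
    have huB : u ∈ dB Γ U B {x} := mem_dB.2 ⟨⟨h.sub hu, by simpa using hxu.symm⟩, Or.inl hu⟩
    have hwB : w ∈ dB Γ U B {x} := mem_dB.2 ⟨⟨h.sub hw, by simpa using hxw.ne.symm⟩, Or.inl hw⟩
    obtain ⟨φ', c', h1, h2⟩ := thom hΓ hI huB hwB huw ψ (by rwa [dL_mem hu]) (by rwa [dL_mem hw]) pne
    have hmem : ∀ e ∈ ({a, b} : Finset ℕ), e ∈ L x ∧ e ≠ c := by
      intro e he
      simp only [Finset.mem_insert, Finset.mem_singleton] at he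
      rcases he with rfl | rfl
      · exact ⟨ha, hca.symm⟩
      · exact ⟨hb, hcb.symm⟩
    obtain ⟨e, he, hen⟩ : ∃ e ∈ ({a, b} : Finset ℕ), ∀ n ∈ B, Γ.Adj x n → n ≠ w → e ≠ φ' n := by
      by_cases hn : ∃ n ∈ B, Γ.Adj x n ∧ n ≠ w
      · obtain ⟨n, hn, hxn, hnw⟩ := hn
        obtain ⟨e, he, hem⟩ := exists_avoid1 (s := {a, b}) (by rw [Finset.card_pair hab]) (φ' n)
        refine ⟨e, he, fun k hk hxk hkw => ?_⟩
        by_cases hkn : k = n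
        · subst hkn; exact hem
        · exact (factA hΓ h.toSt hns hx hw hn hk hxw hxn hxk hnw.symm (Ne.symm hkw) (Ne.symm hkn)).elim
      · push Not at hn
        exact ⟨a, by simp, fun k hk hxk hkw => absurd (hn k hk hxk) hkw⟩
    obtain ⟨φ, f1, f2, f3⟩ := del1 c' (hmem e he).1 he (fun n hn hxn => by
      by_cases hnw : n = w
      · subst hnw; rw [h2, hwc]; exact (hmem e he).2
      · exact hen n hn hxn hnw)
    have fw : φ w = c := by rw [f3 w hxw.ne.symm, h2, hwc]
    refine ⟨φ, f1, by rw [f3 u hxu.symm, h1], by rw [fw, hwc], ?_⟩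
    simp only [Src.ok, fw]
    exact ⟨fun h => hcb h.2, fun h => hca h.2⟩
  · obtain ⟨φ', c', h1, h2, hQ⟩ := hτ ψ (by rwa [dL_mem hu]) (by rwa [dL_mem hw]) pne hok
    obtain ⟨φ, f1, f2, f3⟩ := del1 c' hc (by simp) (fun n hn hxn => by
      by_cases hnw : n = w
      · subst hnw; rw [h2]; exact Ne.symm hwc
      · exact (hQ n hn hxn hnw).symm)
    refine ⟨φ, f1, by rw [f3 u hxu.symm, h1], by rw [f3 w hxw.ne.symm, h2], ?_⟩
    simp only [Src.ok, f2]
    exact ⟨fun h => hca h.1, fun h => hcb h.1⟩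

lemma starE_far (hΓ : NoMin Γ) {U B : Finset W} {S : Set W} {L : W → Finset ℕ}
    (h : Inst Γ U B S L) (ih : IH Γ U.card) (hns : NS Γ U B) {x y : W} {a b : ℕ} (hx : x ∈ B)
    (hy : y ∈ B) (hxy : Γ.Adj x y) (ha : a ∈ L x) (ha' : a ∈ L y)
    {u w : W} (hu : u ∈ B) (hw : w ∈ B) (huw : Γ.Adj u w) (hxu : x ≠ u) (hxw : x ≠ w)
    (hyu : y ≠ u) (hyw : y ≠ w) :
    Gd Γ U L (Src.E x y a b).ok u w := by
  obtain ⟨c, hc, hca, hcb⟩ := exists_avoid2 (h.l3 x hx) a b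
  by_cases hcy : c ∈ L y
  · have hA : Alt Γ B L (Src.E x y a b).ok u w a c {x, y} (fun v => decide (v = x)) := by
      refine ⟨?_, ?_, ?_, ?_, ?_, ?_, ?_⟩
      · intro v hv
        simp only [Finset.mem_insert, Finset.mem_singleton] at hv
        rcases hv with rfl | rfl <;> assumption
      · simp [hxu.symm, hyu.symm]
      · simp [hxw.symm, hyw.symm]
      · intro v hv
        simp only [Finset.mem_insert, Finset.mem_singleton] at hv
        rcases hv with rfl | rfl <;> assumption
      · intro v hv
        simp only [Finset.mem_insert, Finset.mem_singleton] at hv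
        rcases hv with rfl | rfl <;> assumption
      · intro p hp q hq hpq
        simp only [Finset.mem_insert, Finset.mem_singleton] at hp hq
        have := hpq.ne
        have := hpq.ne.symm
        rcases hp with rfl | rfl <;> rcases hq with rfl | rfl <;> simp_all
      · intro s φ hφ
        have e1 := hφ x (by simp)
        have e2 := hφ y (by simp)
        simp only [Src.ok, e1, e2]
        cases s <;> simp [pk, hxy.ne.symm, hca, hcb]
    have ux : ∀ n ∈ B, ∀ k ∈ B, Γ.Adj x n → Γ.Adj x k → n ≠ y → k ≠ y → k = n := by
      intro n hn k hk hxn hxk hny hky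
      by_contra hkn
      exact factA hΓ h.toSt hns hx hy hn hk hxy hxn hxk hny.symm (Ne.symm hky) (Ne.symm hkn)
    have uy : ∀ n ∈ B, ∀ k ∈ B, Γ.Adj y n → Γ.Adj y k → n ≠ x → k ≠ x → k = n := by
      intro n hn k hk hxn hxk hny hky
      by_contra hkn
      exact factA hΓ h.toSt hns hy hx hn hk hxy.symm hxn hxk hny.symm (Ne.symm hky) (Ne.symm hkn)
    by_cases h1 : ∃ n1 ∈ B, Γ.Adj x n1 ∧ n1 ≠ y
    · obtain ⟨n1, hn1, a1, hne1⟩ := h1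
      by_cases h2 : ∃ n2 ∈ B, Γ.Adj y n2 ∧ n2 ≠ x
      · obtain ⟨n2, hn2, a2, hne2⟩ := h2
        have hne : n1 ≠ n2 := by
          rintro rfl
          by_cases hn1u : u = n1
          · have : w ≠ n1 := fun e => huw.ne (hn1u.trans e.symm)
            exact factB hΓ h.toSt hns hx hy hn1 hw hxy a1 a2 hxw.symm hyw.symm this
          · exact factB hΓ h.toSt hns hx hy hn1 hu hxy a1 a2 hxu.symm hyu.symm hn1u
        refine run hΓ h hns ih hu hw huw hca.symm _ {x, y} _ le_rfl hA x n1 y n2 (by simp) (by simp)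
          hn1 (by simp [a1.ne.symm, hne1]) hn2 (by simp [a2.ne.symm, hne2]) hne a1 a2 ?_
        intro p hp n hn hnP hpn
        simp only [Finset.mem_insert, Finset.mem_singleton, not_or] at hp hnP
        rcases hp with rfl | rfl
        · exact Or.inl ⟨rfl, ux n1 hn1 n hn a1 hpn hne1 hnP.2⟩
        · exact Or.inr ⟨rfl, uy n2 hn2 n hn a2 hpn hne2 hnP.1⟩
      · push Not at h2
        refine runOne hΓ h hu hw huw hca.symm hA x n1 ?_
        intro p hp n hn hnP hpn
        simp only [Finset.mem_insert, Finset.mem_singleton, not_or] at hp hnP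
        rcases hp with rfl | rfl
        · exact ⟨rfl, ux n1 hn1 n hn a1 hpn hne1 hnP.2⟩
        · exact absurd (h2 n hn hpn) hnP.1
    · push Not at h1
      by_cases h2 : ∃ n2 ∈ B, Γ.Adj y n2 ∧ n2 ≠ x
      · obtain ⟨n2, hn2, a2, hne2⟩ := h2
        refine runOne hΓ h hu hw huw hca.symm hA y n2 ?_
        intro p hp n hn hnP hpn
        simp only [Finset.mem_insert, Finset.mem_singleton, not_or] at hp hnP
        rcases hp with rfl | rfl
        · exact absurd (h1 n hn hpn) hnP.2
        · exact ⟨rfl, uy n2 hn2 n hn a2 hpn hne2 hnP.1⟩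
      · push Not at h2
        refine runOne hΓ h hu hw huw hca.symm hA x x ?_
        intro p hp n hn hnP hpn
        simp only [Finset.mem_insert, Finset.mem_singleton, not_or] at hp hnP
        rcases hp with rfl | rfl
        · exact absurd (h1 n hn hpn) hnP.2
        · exact absurd (h2 n hn hpn) hnP.1
  · refine (gdOther hΓ h ih hns hx hy hxy c hu hw huw hxu hxw).lift (dL_mem hu) (dL_mem hw) ?_
    intro φ' c' hQ
    obtain ⟨φ, f1, f2, f3⟩ := del1 c' hc (by simp) (fun n hn hxn => by
      by_cases hny : n = y
      · subst hny
        have := dL_sub (c'.1 n (Finset.mem_sdiff.2 ⟨h.sub hn, by simpa using hxn.ne.symm⟩))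
        exact fun e => hcy (e ▸ this)
      · exact (hQ n hn hxn hny).symm)
    refine ⟨φ, f1, f3 u hxu.symm, f3 w hxw.symm, ?_⟩
    simp only [Src.ok, f2]
    exact ⟨fun h => hca h.1, fun h => hcb h.1⟩

lemma ok_symm {x y : W} {a b : ℕ} {φ : W → ℕ} (h : (Src.E x y a b).ok φ) : (Src.E y x a b).ok φ :=
  ⟨fun e => h.2 ⟨e.2, e.1⟩, fun e => h.1 ⟨e.2, e.1⟩⟩

lemma starE (hΓ : NoMin Γ) {U B : Finset W} {S : Set W} {L : W → Finset ℕ}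
    (h : Inst Γ U B S L) (ih : IH Γ U.card) (hns : NS Γ U B) {x y : W} {a b : ℕ}
    (hσ : (Src.E x y a b).In Γ B) {u w : W} (hu : u ∈ B) (hw : w ∈ B) (huw : Γ.Adj u w) :
    Gd Γ U L (Src.E x y a b).ok u w := by
  by_cases hon : (Src.E x y a b).On u w
  · refine ⟨.E x y a b, hon, fun ψ a b c d => ?_⟩
    obtain ⟨φ, h1, h2, h3⟩ := TL.thom hΓ h hu hw huw ψ a b c
    exact ⟨φ, h1, h2, h3, hon.congr h2.symm h3.symm d⟩
  obtain ⟨hx, hy, hxy, hab⟩ := hσ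
  have hxU := h.sub hx
  have hyU := h.sub hy
  simp only [Src.On, not_and_or, not_or] at hon
  replace hon := hon.resolve_right (fun e => e hab)
  by_cases c1 : a ∈ L x
  swap
  · refine (starV hΓ h ih hns (v := y) (p := a) hy hu hw huw).mono fun φ hc hok => ?_
    have := hc.1 x hxU
    exact ⟨fun e => c1 (e.1 ▸ this), fun e => hok e.2⟩
  by_cases c2 : b ∈ L x
  swap
  · refine (starV hΓ h ih hns (v := y) (p := b) hy hu hw huw).mono fun φ hc hok => ?_
    have := hc.1 x hxU
    exact ⟨fun e => hok e.2, fun e => c2 (e.1 ▸ this)⟩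
  by_cases c3 : a ∈ L y
  swap
  · refine (starV hΓ h ih hns (v := x) (p := a) hx hu hw huw).mono fun φ hc hok => ?_
    have := hc.1 y hyU
    exact ⟨fun e => hok e.1, fun e => c3 (e.2 ▸ this)⟩
  by_cases c4 : b ∈ L y
  swap
  · refine (starV hΓ h ih hns (v := x) (p := b) hx hu hw huw).mono fun φ hc hok => ?_
    have := hc.1 y hyU
    exact ⟨fun e => c4 (e.2 ▸ this), fun e => hok e.1⟩
  by_cases yw : y = w
  · subst yw
    have hxu : x ≠ u := fun e => hon.1.elim (fun h => h e) (fun h => h rfl)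
    exact starE_shared hΓ h ih hns hx hab c1 c2 hu hw huw hxu hxy
  by_cases yu : y = u
  · subst yu
    have hxu : x ≠ w := fun e => hon.2.elim (fun h => h e) (fun h => h rfl)
    exact (starE_shared hΓ h ih hns hx hab c1 c2 hw hu huw.symm hxu hxy).symm
  by_cases xw : x = w
  · subst xw
    exact (starE_shared hΓ h ih hns hy hab c3 c4 hu hw huw yu hxy.symm).mono fun φ _ e => ok_symm e
  by_cases xu : x = u
  · subst xu
    exact (starE_shared hΓ h ih hns hy hab c3 c4 hw hu huw.symm yw hxy.symm).symm.mono
      fun φ _ e => ok_symm e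
  exact starE_far hΓ h ih hns hx hy hxy c1 c3 hu hw huw xu xw yu yw

lemma star (hΓ : NoMin Γ) : ∀ n : ℕ, IH Γ n := by
  intro n
  induction n with
  | zero => intro U B S L _ h; omega
  | succ n ihn =>
    intro U B S L h hU σ hσ u hu w hw huw
    have ih : IH Γ U.card := fun U' B' S' L' h' hU' => ihn U' B' S' L' h' (by omega)
    by_cases hns : NS Γ U B
    · cases σ with
      | V v p => exact starV hΓ h ih hns hσ hu hw huw
      | E x y a b => exact starE hΓ h ih hns hσ hu hw huw
    · obtain ⟨s, hs, t, ht, hst, U1, U2, hsp⟩ := exists_sp h.sub hns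
      have : σ.In Γ (B.filter (· ∈ U1)) ∨ σ.In Γ (B.filter (· ∈ U2)) := by
        cases σ with
        | V v p =>
          rcases (hsp.un v).1 (h.sub hσ) with h1 | h1
          · exact Or.inl (Finset.mem_filter.2 ⟨hσ, h1⟩)
          · exact Or.inr (Finset.mem_filter.2 ⟨hσ, h1⟩)
        | E x y a b =>
          obtain ⟨hx, hy, hxy, hab⟩ := hσ
          rcases hsp.clique (h.sub hx) (h.sub hy) hxy with ⟨h1, h2⟩ | ⟨h1, h2⟩
          · exact Or.inl ⟨Finset.mem_filter.2 ⟨hx, h1⟩, Finset.mem_filter.2 ⟨hy, h2⟩, hxy, hab⟩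
          · exact Or.inr ⟨Finset.mem_filter.2 ⟨hx, h1⟩, Finset.mem_filter.2 ⟨hy, h2⟩, hxy, hab⟩
      rcases this with h1 | h1
      · exact split_case hΓ h ih hsp hs ht hst h1 hu hw huw
      · exact split_case hΓ h ih hsp.symm hs ht hst h1 hu hw huw

/-- final combinatorial statement -/
lemma two_lists (hΓ : NoMin Γ) {U B : Finset W} {S : Set W} {L : W → Finset ℕ} (h : St Γ U B S)
    {v1 v2 x : W} (hv1 : v1 ∈ B) (hv2 : v2 ∈ B) (hx : x ∈ B) (hxv : Γ.Adj v2 x)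
    (h1 : 2 ≤ (L v1).card) (h2 : 2 ≤ (L v2).card)
    (l3 : ∀ v ∈ B, v ≠ v1 → v ≠ v2 → 3 ≤ (L v).card)
    (l5 : ∀ v ∈ U, v ∉ B → 5 ≤ (L v).card) : ∃ φ, Col Γ U L φ := by
  obtain ⟨p, hp1, hp2⟩ : ∃ p : ℕ, p ∉ L v1 ∧ p ∉ L v2 := by
    obtain ⟨p, hp⟩ := Infinite.exists_notMem_finset (L v1 ∪ L v2)
    simp only [Finset.mem_union, not_or] at hp
    exact ⟨p, hp⟩
  obtain ⟨L', hL'⟩ : ∃ L' : W → Finset ℕ, ∀ v, L' v = if v = v1 ∨ v = v2 then insert p (L v) else L v :=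
    ⟨_, fun _ => rfl⟩
  have hI : Inst Γ U B S L' := by
    refine ⟨h, ?_, ?_⟩
    · intro v hv
      rw [hL']
      split_ifs with hc
      · rcases hc with rfl | rfl
        · rw [Finset.card_insert_of_notMem hp1]; omega
        · rw [Finset.card_insert_of_notMem hp2]; omega
      · push Not at hc
        exact l3 v hv hc.1 hc.2
    · intro v hv hvB
      rw [hL', if_neg]
      · exact l5 v hv hvB
      · rintro (rfl | rfl)
        · exact hvB hv1
        · exact hvB hv2
  obtain ⟨τ, ht, hτ⟩ := star hΓ (U.card + 1) U B S L' hI (by omega) (.V v1 p) hv1 v2 hv2 x hx hxv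
  -- choose colours on the edge
  obtain ⟨c, hc, d, hd, hcd, hok⟩ : ∃ c ∈ L v2, ∃ d ∈ L' x, c ≠ d ∧
      ∀ ψ : W → ℕ, ψ v2 = c → ψ x = d → τ.ok ψ := by
    have hx3 := hI.l3 x hx
    cases τ with
    | V v q =>
      rcases ht with rfl | rfl
      · obtain ⟨c, hc, hcq⟩ := exists_avoid1 h2 q
        obtain ⟨d, hd, hdc⟩ := exists_avoid1 (s := L' x) (by omega) c
        exact ⟨c, hc, d, hd, hdc.symm, fun ψ e1 e2 => by simpa [Src.ok, e1] using hcq⟩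
      · obtain ⟨c, hc, hcq⟩ := exists_avoid1 h2 q
        obtain ⟨d, hd, hdc, hdq⟩ := exists_avoid2 hx3 c q
        exact ⟨c, hc, d, hd, hdc.symm, fun ψ e1 e2 => by simpa [Src.ok, e2] using hdq⟩
    | E s t q r =>
      by_cases hq : ∃ c ∈ L v2, c ≠ q ∧ c ≠ r
      · obtain ⟨c, hc, hcq, hcr⟩ := hq
        obtain ⟨d, hd, hdc⟩ := exists_avoid1 (s := L' x) (by omega) c
        refine ⟨c, hc, d, hd, hdc.symm, fun ψ e1 e2 => ?_⟩
        obtain ⟨⟨rfl, rfl⟩ | ⟨rfl, rfl⟩, -⟩ := ht <;> simp only [Src.ok, e1] <;> tauto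
      · push Not at hq
        obtain ⟨c, hc⟩ : (L v2).Nonempty := Finset.card_pos.1 (by omega)
        have hc' : c = q ∨ c = r := by
          by_cases e : c = q
          · exact Or.inl e
          · exact Or.inr (hq c hc e)
        obtain ⟨d, hd, hdq, hdr⟩ := exists_avoid2 hx3 q r
        refine ⟨c, hc, d, hd, ?_, fun ψ e1 e2 => ?_⟩
        · rintro rfl; tauto
        · obtain ⟨⟨rfl, rfl⟩ | ⟨rfl, rfl⟩, -⟩ := ht <;> simp only [Src.ok, e2] <;> tauto
  have hxne : x ≠ v2 := hxv.ne.symm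
  obtain ⟨φ, f1, f2, f3, f4⟩ := hτ (fun v => if v = v2 then c else d)
    (by simp only [if_true]; rw [hL', if_pos (Or.inr rfl)]; exact Finset.mem_insert_of_mem hc)
    (by simpa [hxne] using hd) (by simpa [hxne] using hcd) (hok _ (by simp) (by simp [hxne]))
  simp only [if_true] at f2
  refine ⟨φ, fun v hv => ?_, f1.2⟩
  have hm := f1.1 v hv
  rw [hL'] at hm
  split_ifs at hm with hcase
  · rw [Finset.mem_insert] at hm
    rcases hm with hm | hm
    · rcases hcase with rfl | rfl
      · exact absurd hm f4
      · rw [f2]; exact hc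
    · exact hm
  · exact hm

end starE
end TL

namespace TL

section wind

lemma log_unique {f1 f2 : ℝ → ℂ} (h1 : Continuous f1) (h2 : Continuous f2)
    (h : ∀ t, Complex.exp (f1 t) = Complex.exp (f2 t)) : f1 1 - f1 0 = f2 1 - f2 0 := by
  have key : f1 = fun t => f2 t + (f1 0 - f2 0) := by
    refine Complex.isCoveringMap_exp.eq_of_comp_eq h1 (by fun_prop) ?_ 0 (by ring)
    funext t
    apply Subtype.ext
    show Complex.exp (f1 t) = Complex.exp (f2 t + (f1 0 - f2 0))
    rw [Complex.exp_add, Complex.exp_sub, h 0, div_self (Complex.exp_ne_zero _), mul_one, h t]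
  have := congrFun key 1
  rw [this]; ring

lemma exists_log {X : Type} [TopologicalSpace X] [SimplyConnectedSpace X] [LocallyPathConnectedSpace X]
    {g : X → ℂ} (hg : Continuous g) (h0 : ∀ t, g t ≠ 0) :
    ∃ f : X → ℂ, Continuous f ∧ ∀ t, Complex.exp (f t) = g t := by
  haveI : Nonempty X := inferInstance
  obtain ⟨x₀⟩ := this
  rcases Complex.isCoveringMapOn_exp.existsUnique_continuousMap_lifts
    ⟨g, hg⟩ (Complex.exp_log (h0 x₀)) (fun x ↦ h0 x) with ⟨f, ⟨-, hf⟩, -⟩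
  exact ⟨f, f.continuous, fun t => congrFun hf t⟩

def IsVar (g : ℝ → ℂ) (v : ℂ) : Prop :=
  ∃ f : ℝ → ℂ, Continuous f ∧ (∀ t, Complex.exp (f t) = g t) ∧ v = f 1 - f 0

lemma IsVar.unique {g : ℝ → ℂ} {v w : ℂ} (h : IsVar g v) (h' : IsVar g w) : v = w := by
  obtain ⟨f, hf, e, rfl⟩ := h
  obtain ⟨f', hf', e', rfl⟩ := h'
  exact log_unique hf hf' (fun t => by rw [e, e'])

lemma IsVar.neg {g : ℝ → ℂ} {v : ℂ} (h : IsVar g v) : IsVar (fun t => - g t) v := by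
  obtain ⟨f, hf, e, rfl⟩ := h
  refine ⟨fun t => f t + Real.pi * Complex.I, by fun_prop, fun t => ?_, by ring⟩
  rw [Complex.exp_add, Complex.exp_pi_mul_I, e]; ring

lemma exists_isVar {g : ℝ → ℂ} (hg : Continuous g) (h0 : ∀ t, g t ≠ 0) : ∃ v, IsVar g v := by
  obtain ⟨f, hf, e⟩ := exists_log hg h0
  exact ⟨_, f, hf, e, rfl⟩

lemma cross {a b : ℝ → ℂ} (ha : Continuous a) (hb : Continuous b) (hd : ∀ s t, a s ≠ b t)
    {vk vl vi vj : ℂ} (hk : IsVar (fun s => a s - b 0) vk) (hl : IsVar (fun s => a s - b 1) vl)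
    (hi : IsVar (fun t => b t - a 0) vi) (hj : IsVar (fun t => b t - a 1) vj) :
    vk + vj = vi + vl := by
  obtain ⟨F, hF, e⟩ := exists_log (X := ℝ × ℝ) (g := fun p => a p.1 - b p.2) (by fun_prop)
    (fun p => sub_ne_zero.2 (hd _ _))
  have e1 : vk = F (1, 0) - F (0, 0) :=
    hk.unique ⟨fun s => F (s, 0), by fun_prop, fun t => e _, rfl⟩
  have e2 : vl = F (1, 1) - F (0, 1) :=
    hl.unique ⟨fun s => F (s, 1), by fun_prop, fun t => e _, rfl⟩
  have e3 : vi = F (0, 1) - F (0, 0) := by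
    refine hi.neg.unique ⟨fun s => F (0, s), by fun_prop, fun t => ?_, rfl⟩
    rw [e]; ring
  have e4 : vj = F (1, 1) - F (1, 0) := by
    refine hj.neg.unique ⟨fun s => F (1, s), by fun_prop, fun t => ?_, rfl⟩
    rw [e]; ring
  rw [e1, e2, e3, e4]; ring

lemma exists_theta {m : ℕ} (x : Fin m → ℂ) (hx : Function.Injective x) :
    ∃ Θ : Fin m → Fin m → ℂ, (∀ k j, k ≠ j → Complex.exp (Θ k j) = x j - x k) ∧
      ∀ k j, k < j → Θ j k = Θ k j + Real.pi * Complex.I := by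
  refine ⟨fun k j => if k < j then Complex.log (x j - x k) else
    Complex.log (x k - x j) + Real.pi * Complex.I, fun k j h => ?_, fun k j h => ?_⟩
  · have h1 : x j - x k ≠ 0 := sub_ne_zero.2 fun e => h (hx e.symm)
    have h2 : x k - x j ≠ 0 := sub_ne_zero.2 fun e => h (hx e)
    simp only
    split_ifs
    · exact Complex.exp_log h1
    · rw [Complex.exp_add, Complex.exp_pi_mul_I, Complex.exp_log h2]; ring
  · simp [h, h.not_gt]

/-- sign -/
def eps {m : ℕ} (a b : Fin m) : ℤ := if a < b then -1 else 1

lemma drawing_eqs {m : ℕ} (x : Fin m → ℂ) (hx : Function.Injective x) (P : Fin m → Fin m → Prop)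
    (γ : Fin m → Fin m → ℝ → ℂ) (hc : ∀ i j, P i j → Continuous (γ i j))
    (h0 : ∀ i j, P i j → γ i j 0 = x i) (h1 : ∀ i j, P i j → γ i j 1 = x j)
    (hd : ∀ i j k l, P i j → P k l → i ≠ k → i ≠ l → j ≠ k → j ≠ l → ∀ s t, γ i j s ≠ γ k l t)
    (hv : ∀ i j k, P i j → k ≠ i → k ≠ j → ∀ s, γ i j s ≠ x k) :
    ∃ n : Fin m → Fin m → Fin m → ℤ, ∀ i j k l, P i j → P k l → i ≠ k → i ≠ l → j ≠ k → j ≠ l →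
      2 * (n k i j + n j k l - n i k l - n l i j) =
        - (eps k j + eps i k + eps j l + eps l i) := by
  obtain ⟨Θ, hΘ, hΘ'⟩ := exists_theta x hx
  have hV : ∀ k i j, ∃ n : ℤ, P i j → k ≠ i → k ≠ j →
      IsVar (fun s => γ i j s - x k) (Θ k j - Θ k i + n * (2 * Real.pi * Complex.I)) := by
    intro k i j
    by_cases h : P i j ∧ k ≠ i ∧ k ≠ j
    · obtain ⟨hP, hki, hkj⟩ := h
      have hcc := hc i j hP
      obtain ⟨v, hvv⟩ := exists_isVar (g := fun s => γ i j s - x k) (by fun_prop)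
        (fun t => sub_ne_zero.2 (hv i j k hP hki hkj t))
      have hvv' := hvv
      obtain ⟨f, hf, e, rfl⟩ := hvv
      have : Complex.exp (f 1 - f 0) = Complex.exp (Θ k j - Θ k i) := by
        rw [Complex.exp_sub, Complex.exp_sub, e, e, hΘ _ _ hki, hΘ _ _ hkj]
        simp only [h0 _ _ hP, h1 _ _ hP]
      obtain ⟨n, hn⟩ := Complex.exp_eq_exp_iff_exists_int.1 this
      exact ⟨n, fun _ _ _ => hn ▸ hvv'⟩
    · exact ⟨0, fun a b c => absurd ⟨a, b, c⟩ h⟩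
  choose n hn using hV
  have hE : ∀ a b, a ≠ b → Θ a b = Θ b a + (eps a b) * (Real.pi * Complex.I) := by
    intro a b hab
    rcases lt_or_gt_of_ne hab with h | h
    · rw [hΘ' _ _ h, eps, if_pos h]; push_cast; ring
    · rw [hΘ' _ _ h, eps, if_neg h.not_gt]; push_cast; ring
  refine ⟨n, fun i j k l hij hkl hik hil hjk hjl => ?_⟩
  have hh := cross (hc i j hij) (hc k l hkl) (hd i j k l hij hkl hik hil hjk hjl)
    (by rw [h0 _ _ hkl]; exact hn k i j hij hik.symm hjk.symm)
    (by rw [h1 _ _ hkl]; exact hn l i j hij hil.symm hjl.symm)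
    (by rw [h0 _ _ hij]; exact hn i k l hkl hik hil)
    (by rw [h1 _ _ hij]; exact hn j k l hkl hjk hjl)
  rw [hE k j hjk.symm, hE i k hik, hE j l hjl, hE l i hil.symm] at hh
  have hpi : (Real.pi : ℂ) * Complex.I ≠ 0 :=
    mul_ne_zero (by exact_mod_cast Real.pi_ne_zero) Complex.I_ne_zero
  have h3 : ((2 * (n k i j + n j k l - n i k l - n l i j) +
      (eps k j + eps i k + eps j l + eps l i) : ℤ) : ℂ) * (Real.pi * Complex.I) = 0 := by
    push_cast
    linear_combination hh
  have h4 := (mul_eq_zero.1 h3).resolve_right hpi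
  have h5 : 2 * (n k i j + n j k l - n i k l - n l i j) +
      (eps k j + eps i k + eps j l + eps l i) = 0 := by exact_mod_cast h4
  omega

lemma no_K5 (x : Fin 5 → ℂ) (hx : Function.Injective x)
    (γ : Fin 5 → Fin 5 → ℝ → ℂ) (hc : ∀ i j, i < j → Continuous (γ i j))
    (h0 : ∀ i j, i < j → γ i j 0 = x i) (h1 : ∀ i j, i < j → γ i j 1 = x j)
    (hd : ∀ i j k l, i < j → k < l → i ≠ k → i ≠ l → j ≠ k → j ≠ l → ∀ s t, γ i j s ≠ γ k l t)
    (hv : ∀ i j k, i < j → k ≠ i → k ≠ j → ∀ s, γ i j s ≠ x k) : False := by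
  obtain ⟨n, hn⟩ := drawing_eqs x hx (· < ·) γ hc h0 h1 hd hv
  have H : ∀ i j k l, i < j ∧ k < l ∧ i ≠ k ∧ i ≠ l ∧ j ≠ k ∧ j ≠ l →
      2 * (n k i j + n j k l - n i k l - n l i j) =
        - (eps k j + eps i k + eps j l + eps l i) := fun i j k l h =>
    hn i j k l h.1 h.2.1 h.2.2.1 h.2.2.2.1 h.2.2.2.2.1 h.2.2.2.2.2
  have a1 := H 0 1 2 3 (by decide)
  have a2 := H 0 2 1 3 (by decide)
  have a3 := H 0 3 1 2 (by decide)
  have b1 := H 0 1 2 4 (by decide)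
  have b2 := H 0 2 1 4 (by decide)
  have b3 := H 0 4 1 2 (by decide)
  have c1 := H 0 1 3 4 (by decide)
  have c2 := H 0 3 1 4 (by decide)
  have c3 := H 0 4 1 3 (by decide)
  have d1 := H 0 2 3 4 (by decide)
  have d2 := H 0 3 2 4 (by decide)
  have d3 := H 0 4 2 3 (by decide)
  have e1 := H 1 2 3 4 (by decide)
  have e2 := H 1 3 2 4 (by decide)
  have e3 := H 1 4 2 3 (by decide)
  simp [eps] at a1 a2 a3 b1 b2 b3 c1 c2 c3 d1 d2 d3 e1 e2 e3
  omega

lemma no_K33 (x : Fin 6 → ℂ) (hx : Function.Injective x) (P : Fin 6 → Fin 6 → Prop)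
    (hP : ∀ i j, P i j ↔ i < j ∧ i.val < 3 ∧ 3 ≤ j.val)
    (γ : Fin 6 → Fin 6 → ℝ → ℂ) (hc : ∀ i j, P i j → Continuous (γ i j))
    (h0 : ∀ i j, P i j → γ i j 0 = x i) (h1 : ∀ i j, P i j → γ i j 1 = x j)
    (hd : ∀ i j k l, P i j → P k l → i ≠ k → i ≠ l → j ≠ k → j ≠ l → ∀ s t, γ i j s ≠ γ k l t)
    (hv : ∀ i j k, P i j → k ≠ i → k ≠ j → ∀ s, γ i j s ≠ x k) : False := by
  obtain ⟨n, hn⟩ := drawing_eqs x hx P γ hc h0 h1 hd hv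
  have H : ∀ i j k l : Fin 6, (i < j ∧ i.val < 3 ∧ 3 ≤ j.val) ∧ (k < l ∧ k.val < 3 ∧ 3 ≤ l.val) ∧
      i ≠ k ∧ i ≠ l ∧ j ≠ k ∧ j ≠ l →
      2 * (n k i j + n j k l - n i k l - n l i j) =
        - (eps k j + eps i k + eps j l + eps l i) := fun i j k l h =>
    hn i j k l ((hP _ _).2 h.1) ((hP _ _).2 h.2.1) h.2.2.1 h.2.2.2.1 h.2.2.2.2.1 h.2.2.2.2.2
  have a0 := H 0 3 1 4 (by decide)
  have a1 := H 0 3 1 5 (by decide)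
  have a2 := H 0 3 2 4 (by decide)
  have a3 := H 0 3 2 5 (by decide)
  have a4 := H 0 4 1 3 (by decide)
  have a5 := H 0 4 1 5 (by decide)
  have a6 := H 0 4 2 3 (by decide)
  have a7 := H 0 4 2 5 (by decide)
  have a8 := H 0 5 1 3 (by decide)
  have a9 := H 0 5 1 4 (by decide)
  have a10 := H 0 5 2 3 (by decide)
  have a11 := H 0 5 2 4 (by decide)
  have a12 := H 1 3 2 4 (by decide)
  have a13 := H 1 3 2 5 (by decide)
  have a14 := H 1 4 2 3 (by decide)
  have a15 := H 1 4 2 5 (by decide)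
  have a16 := H 1 5 2 3 (by decide)
  have a17 := H 1 5 2 4 (by decide)
  simp [eps] at a0 a1 a2 a3 a4 a5 a6 a7 a8 a9 a10 a11 a12 a13 a14 a15 a16 a17
  omega

end wind
end TL

namespace TL

section realz
variable {W : Type} {Γ : SimpleGraph W}

structure Realz (Γ : SimpleGraph W) (rep : W → ℝ × ℝ) (A : W → W → Set (ℝ × ℝ)) : Prop where
  inj : Function.Injective rep
  join : ∀ u v, Γ.Adj u v → JoinedIn (A u v) (rep u) (rep v)
  pt : ∀ u v w, Γ.Adj u v → w ≠ u → w ≠ v → rep w ∉ A u v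
  dis : ∀ u v u' v', Γ.Adj u v → Γ.Adj u' v' → u ≠ u' → u ≠ v' → v ≠ u' → v ≠ v' →
    Disjoint (A u v) (A u' v')

variable {rep : W → ℝ × ℝ} {A : W → W → Set (ℝ × ℝ)}

def rho (Γ : SimpleGraph W) (rep : W → ℝ × ℝ) (A : W → W → Set (ℝ × ℝ)) (X : Set W) :
    Set (ℝ × ℝ) :=
  {p | (∃ w ∈ X, rep w = p) ∨ ∃ u ∈ X, ∃ v ∈ X, Γ.Adj u v ∧ p ∈ A u v}

lemma rho_mono {X Y : Set W} (h : X ⊆ Y) : rho Γ rep A X ⊆ rho Γ rep A Y := by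
  rintro p (⟨w, hw, rfl⟩ | ⟨u, hu, v, hv, h1, h2⟩)
  · exact Or.inl ⟨w, h hw, rfl⟩
  · exact Or.inr ⟨u, h hu, v, h hv, h1, h2⟩

lemma Realz.disj (H : Realz Γ rep A) {X Y : Set W} (h : Disjoint X Y) :
    Disjoint (rho Γ rep A X) (rho Γ rep A Y) := by
  have hne : ∀ {x y}, x ∈ X → y ∈ Y → x ≠ y := fun hx hy e =>
    Set.disjoint_left.1 h hx (e ▸ hy)
  rw [Set.disjoint_left]
  rintro p (⟨w, hw, rfl⟩ | ⟨u, hu, v, hv, h1, h2⟩) (⟨w', hw', e⟩ | ⟨u', hu', v', hv', h1', h2'⟩)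
  · exact hne hw hw' (H.inj e.symm)
  · exact H.pt _ _ _ h1' (hne hw hu') (hne hw hv') h2'
  · exact H.pt _ _ _ h1 (hne hu hw').symm (hne hv hw').symm (e ▸ h2)
  · exact Set.disjoint_left.1 (H.dis _ _ _ _ h1 h1' (hne hu hu') (hne hu hv') (hne hv hu')
      (hne hv hv')) h2 h2'

lemma Realz.edge (H : Realz Γ rep A) {X : Set W} {u v : W} (hu : u ∈ X) (hv : v ∈ X)
    (h : Γ.Adj u v) : JoinedIn (rho Γ rep A X) (rep u) (rep v) :=
  (H.join u v h).mono fun _ hp => Or.inr ⟨u, hu, v, hv, h, hp⟩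

lemma Realz.rch (H : Realz Γ rep A) {X : Set W} {r x : W} (hr : r ∈ X) (h : Rch Γ X r x) :
    JoinedIn (rho Γ rep A X) (rep r) (rep x) := by
  induction h with
  | refl => exact JoinedIn.refl (Or.inl ⟨r, hr, rfl⟩)
  | @tail b c h1 h2 ih => exact ih.trans (H.edge (Rch.mem h1 hr) h2.2 h2.1)

lemma Realz.minor (H : Realz Γ rep A) {m : ℕ} {R : Fin m → Fin m → Prop} (h : HasMinor Γ m R) :
    ∃ (x : Fin m → ℂ) (γ : Fin m → Fin m → ℝ → ℂ), Function.Injective x ∧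
      (∀ i j, i < j ∧ R i j → Continuous (γ i j)) ∧
      (∀ i j, i < j ∧ R i j → γ i j 0 = x i) ∧ (∀ i j, i < j ∧ R i j → γ i j 1 = x j) ∧
      (∀ i j k l, i < j ∧ R i j → k < l ∧ R k l → i ≠ k → i ≠ l → j ≠ k → j ≠ l →
        ∀ s t, γ i j s ≠ γ k l t) ∧
      (∀ i j k, i < j ∧ R i j → k ≠ i → k ≠ j → ∀ s, γ i j s ≠ x k) := by
  obtain ⟨S, hS, hd, hA⟩ := h
  choose r hr hc using hS
  have hJ : ∀ i j, ∃ γ : ℝ → ℝ × ℝ, i < j ∧ R i j → Continuous γ ∧ γ 0 = rep (r i) ∧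
      γ 1 = rep (r j) ∧ ∀ t, γ t ∈ rho Γ rep A (S i ∪ S j) := by
    intro i j
    by_cases h : i < j ∧ R i j
    · obtain ⟨a, ha, b, hb, hab⟩ := hA i j h.1 h.2
      have h1 := (H.rch (hr i) (hc i a ha)).mono (rho_mono subset_union_left (Y := S i ∪ S j))
      have h2 := (H.rch (hr j) (hc j b hb)).mono (rho_mono subset_union_right (Y := S i ∪ S j))
      have h3 := H.edge (X := S i ∪ S j) (Or.inl ha) (Or.inr hb) hab
      obtain ⟨p, hp⟩ := (h1.trans h3).trans h2.symm
      refine ⟨p.extend, fun _ => ⟨p.extend.continuous, p.extend_zero, p.extend_one, fun t => ?_⟩⟩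
      have : p.extend t ∈ range p := by rw [← p.extend_range]; exact ⟨t, rfl⟩
      obtain ⟨t', ht'⟩ := this
      rw [← ht']; exact hp t'
    · exact ⟨fun _ => 0, fun h' => absurd h' h⟩
  choose γ hγ using hJ
  let e := Complex.equivRealProdCLM.symm
  have he : Function.Injective e := e.injective
  have hru : ∀ i j, i ≠ j → Disjoint (S i) (S j) := hd
  refine ⟨fun i => e (rep (r i)), fun i j t => e (γ i j t), ?_, ?_, ?_, ?_, ?_, ?_⟩
  · intro i j hij
    by_contra hne
    have := H.inj (he hij)
    exact Set.disjoint_left.1 (hd i j hne) (hr i) (this ▸ hr j)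
  · intro i j h
    exact e.continuous.comp (hγ i j h).1
  · intro i j h
    simp only [(hγ i j h).2.1]
  · intro i j h
    simp only [(hγ i j h).2.2.1]
  · intro i j k l h h' a b c d s t hst
    have h1 := (hγ i j h).2.2.2 s
    have h2 := (hγ k l h').2.2.2 t
    rw [he hst] at h1
    refine Set.disjoint_left.1 (H.disj ?_) h1 h2
    rw [Set.disjoint_union_left, Set.disjoint_union_right, Set.disjoint_union_right]
    exact ⟨⟨hd _ _ a, hd _ _ b⟩, hd _ _ c, hd _ _ d⟩
  · intro i j k h a b s hst
    have h1 := (hγ i j h).2.2.2 s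
    rw [he hst] at h1
    refine Set.disjoint_left.1 (H.disj (Y := S k) ?_) h1 (Or.inl ⟨_, hr k, rfl⟩)
    rw [Set.disjoint_union_left]
    exact ⟨hd _ _ a.symm, hd _ _ b.symm⟩

lemma Realz.noMin (H : Realz Γ rep A) : NoMin Γ := by
  constructor
  · intro h
    obtain ⟨x, γ, a, b, c, d, e, f⟩ := H.minor h
    simp only [and_true] at b c d e f
    exact no_K5 x a γ b c d e f
  · intro h
    obtain ⟨x, γ, a, b, c, d, e, f⟩ := H.minor h
    exact no_K33 x a _ (fun _ _ => Iff.rfl) γ b c d e f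

end realz

section topo

lemma rank_plane : 1 < Module.rank ℝ (ℝ × ℝ) := by
  rw [← Module.finrank_eq_rank]
  simp

lemma joined_far {R : ℝ} (hR : 0 ≤ R) {p q : ℝ × ℝ} (hp : R < ‖p‖) (hq : R < ‖q‖) :
    JoinedIn {z : ℝ × ℝ | R < ‖z‖} p q := by
  have h0 := isPathConnected_compl_singleton_of_one_lt_rank rank_plane (0 : ℝ × ℝ)
  let f : ℝ × ℝ → ℝ × ℝ := fun y => (1 + R * ‖y‖⁻¹) • y
  have hf : ContinuousOn f {0}ᶜ := by
    intro y hy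
    have : ‖y‖ ≠ 0 := norm_ne_zero_iff.2 hy
    refine ContinuousAt.continuousWithinAt ?_
    have : ContinuousAt (fun y : ℝ × ℝ => ‖y‖⁻¹) y := continuous_norm.continuousAt.inv₀ this
    exact (continuousAt_const.add (continuousAt_const.mul this)).smul continuousAt_id
  have h1 := h0.image' hf
  have hs : ∀ z : ℝ × ℝ, R < ‖z‖ → z ∈ f '' {0}ᶜ := by
    intro z hz
    have hz0 : 0 < ‖z‖ := hR.trans_lt hz
    have hpos : 0 < 1 - R * ‖z‖⁻¹ := by
      rw [sub_pos, ← div_eq_mul_inv, div_lt_one hz0]; exact hz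
    refine ⟨(1 - R * ‖z‖⁻¹) • z, ?_, ?_⟩
    · exact smul_ne_zero hpos.ne' (norm_pos_iff.1 hz0)
    · simp only [f]
      rw [norm_smul, Real.norm_of_nonneg hpos.le, smul_smul]
      have h3 : ‖z‖ - R ≠ 0 := by linarith
      have : (1 + R * ((1 - R * ‖z‖⁻¹) * ‖z‖)⁻¹) * (1 - R * ‖z‖⁻¹) = 1 := by
        have e : (1 - R * ‖z‖⁻¹) * ‖z‖ = ‖z‖ - R := by field_simp
        rw [e]
        field_simp
        ring
      rw [this, one_smul]
  refine (h1.joinedIn p (hs p hp) q (hs q hq)).mono ?_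
  rintro _ ⟨y, hy, rfl⟩
  have hy0 : 0 < ‖y‖ := norm_pos_iff.2 hy
  have h4 : 0 ≤ R * ‖y‖⁻¹ := by positivity
  show R < ‖(1 + R * ‖y‖⁻¹) • y‖
  rw [norm_smul, Real.norm_of_nonneg (by linarith), add_mul, mul_assoc, inv_mul_cancel₀ hy0.ne']
  linarith

variable {V : Type} {G : SimpleGraph V} (E : PlaneEmbedding G)

lemma arc_pathConn {e : Sym2 V} (he : e ∈ G.edgeSet) : IsPathConnected (E.arc e) := by
  obtain ⟨γ, h1, -, h3, -⟩ := E.arc_is_arc e he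
  rw [← h3]
  exact ((convex_Icc (0 : ℝ) 1).isPathConnected ⟨0, by simp⟩).image' h1

lemma arc_compact {e : Sym2 V} (he : e ∈ G.edgeSet) : IsCompact (E.arc e) := by
  obtain ⟨γ, h1, -, h3, -⟩ := E.arc_is_arc e he
  rw [← h3]
  exact isCompact_Icc.image_of_continuousOn h1

lemma pos_mem_arc {u v : V} (h : G.Adj u v) : E.pos u ∈ E.arc s(u, v) := by
  obtain ⟨γ, h1, -, h3, h4⟩ := E.arc_is_arc s(u, v) h
  rw [← h3]
  have h5 := h4 u v rfl
  have : E.pos u ∈ ({γ 0, γ 1} : Set (ℝ × ℝ)) := by rw [h5]; simp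
  rcases this with h | h
  · exact ⟨0, by simp, h.symm⟩
  · exact ⟨1, by simp, h.symm⟩

lemma image_compact [Fintype V] : IsCompact E.image := by
  refine (Set.finite_range E.pos).isCompact.union ?_
  exact (Set.toFinite G.edgeSet).isCompact_biUnion fun e he => arc_compact E he

lemma outer_joined [Fintype V] {p q : ℝ × ℝ} (hp : p ∈ E.outerFace) (hq : q ∈ E.outerFace) :
    JoinedIn E.imageᶜ p q := by
  have hI := image_compact E
  obtain ⟨R, hR0, hR⟩ : ∃ R : ℝ, 0 ≤ R ∧ ∀ z ∈ E.image, ‖z‖ ≤ R := by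
    obtain ⟨R, hR⟩ := hI.isBounded.exists_norm_le
    exact ⟨max R 0, le_max_right _ _, fun z hz => (hR z hz).trans (le_max_left _ _)⟩
  have key : ∀ z ∈ E.outerFace, ∃ z', R < ‖z'‖ ∧ JoinedIn E.imageᶜ z z' := by
    intro z hz
    have ho : IsOpen (connectedComponentIn E.imageᶜ z) := hI.isClosed.isOpen_compl.connectedComponentIn
    have hzm : z ∈ connectedComponentIn E.imageᶜ z := mem_connectedComponentIn hz.1
    have hc : IsConnected (connectedComponentIn E.imageᶜ z) :=
      ⟨⟨z, hzm⟩, isPreconnected_connectedComponentIn⟩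
    have hpc := ho.isConnected_iff_isPathConnected.1 hc
    have : ∃ z' ∈ connectedComponentIn E.imageᶜ z, R < ‖z'‖ := by
      by_contra! hcon
      exact hz.2 (isBounded_iff_forall_norm_le.2 ⟨R, hcon⟩)
    obtain ⟨z', hz', hn⟩ := this
    exact ⟨z', hn, (hpc.joinedIn z hzm z' hz').mono (connectedComponentIn_subset _ _)⟩
  obtain ⟨p', hp', jp⟩ := key p hp
  obtain ⟨q', hq', jq⟩ := key q hq
  refine (jp.trans ((joined_far hR0 hp' hq').mono ?_)).trans jq.symm
  intro z hz hzi
  exact absurd (hR z hzi) (not_le.2 hz)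

/-- cone over the vertices in `K` -/
def cone (G : SimpleGraph V) (K : Set V) : SimpleGraph (Option V) where
  Adj a b := match a, b with
    | some u, some v => G.Adj u v
    | none, some v => v ∈ K
    | some v, none => v ∈ K
    | none, none => False
  symm := ⟨by
    rintro (_ | a) (_ | b) h
    · exact h
    · exact h
    · exact h
    · exact SimpleGraph.Adj.symm (G := G) h⟩
  loopless := ⟨by
    rintro (_ | a) h
    · exact h
    · exact G.loopless.irrefl _ h⟩

lemma exists_near [Fintype V] (c : V) (hc : E.pos c ∈ closure E.outerFace) :
    ∃ p ∈ E.outerFace, (∀ w, w ≠ c → E.pos w ∉ segment ℝ p (E.pos c)) ∧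
      ∀ e ∈ G.edgeSet, c ∉ e → Disjoint (E.arc e) (segment ℝ p (E.pos c)) := by
  let T : Set (ℝ × ℝ) := E.pos '' {w | w ≠ c} ∪ ⋃ e ∈ {e | e ∈ G.edgeSet ∧ c ∉ e}, E.arc e
  have hT : IsCompact T := by
    refine (Set.toFinite _).isCompact.union ?_
    exact (Set.toFinite _).isCompact_biUnion fun e he => arc_compact E he.1
  have hcT : E.pos c ∈ Tᶜ := by
    rintro (⟨w, hw, h⟩ | h)
    · exact hw (E.pos_inj h)
    · simp only [mem_iUnion] at h
      obtain ⟨e, he, h⟩ := h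
      exact he.2 (E.arc_inter_pos e he.1 c h)
  obtain ⟨ε, hε, hb⟩ := Metric.isOpen_iff.1 hT.isClosed.isOpen_compl _ hcT
  obtain ⟨p, hp, hd⟩ := Metric.mem_closure_iff.1 hc ε hε
  have hseg : segment ℝ p (E.pos c) ⊆ Tᶜ := by
    refine subset_trans ?_ hb
    refine (convex_ball (E.pos c) ε).segment_subset ?_ (Metric.mem_ball_self hε)
    rw [Metric.mem_ball, dist_comm]; exact hd
  refine ⟨p, hp, fun w hw h => hseg h (Or.inl ⟨w, hw, rfl⟩), fun e he hce => ?_⟩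
  rw [Set.disjoint_left]
  intro z hz hz'
  refine hseg hz' (Or.inr ?_)
  simp only [mem_iUnion]
  exact ⟨e, ⟨he, hce⟩, hz⟩

lemma cone_noMin [Fintype V] {K : Set V} (hK : ∀ c ∈ K, E.pos c ∈ closure E.outerFace)
    {p0 : ℝ × ℝ} (hp0 : p0 ∈ E.outerFace) : NoMin (cone G K) := by
  have hch : ∀ c, ∃ p, c ∈ K → p ∈ E.outerFace ∧
      (∀ w, w ≠ c → E.pos w ∉ segment ℝ p (E.pos c)) ∧
      ∀ e ∈ G.edgeSet, c ∉ e → Disjoint (E.arc e) (segment ℝ p (E.pos c)) := by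
    intro c
    by_cases h : c ∈ K
    · obtain ⟨p, a, b⟩ := exists_near E c (hK c h)
      exact ⟨p, fun _ => ⟨a, b⟩⟩
    · exact ⟨0, fun h' => absurd h' h⟩
  choose pc hpc using hch
  have posI : ∀ v, E.pos v ∈ E.image := fun v => Or.inl ⟨v, rfl⟩
  have arcI : ∀ e ∈ G.edgeSet, E.arc e ⊆ E.image := fun e he z hz =>
    Or.inr (by simp only [mem_iUnion]; exact ⟨e, he, hz⟩)
  let D : V → Set (ℝ × ℝ) := fun c => E.imageᶜ ∪ segment ℝ (pc c) (E.pos c)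
  let rep : Option V → ℝ × ℝ := fun o => o.elim p0 E.pos
  let A : Option V → Option V → Set (ℝ × ℝ) := fun a b => match a, b with
    | some u, some v => E.arc s(u, v)
    | none, some v => D v
    | some v, none => D v
    | none, none => ∅
  have jD : ∀ c ∈ K, JoinedIn (D c) p0 (E.pos c) := by
    intro c hc
    refine JoinedIn.trans (y := pc c) ?_ ?_
    · exact (outer_joined E hp0 (hpc c hc).1).mono subset_union_left
    · exact JoinedIn.of_segment_subset subset_union_right
  have pD : ∀ c ∈ K, ∀ w, w ≠ c → E.pos w ∉ D c := by
    rintro c hc w hw (h | h)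
    · exact h (posI w)
    · exact (hpc c hc).2.1 w hw h
  have dD : ∀ c ∈ K, ∀ e ∈ G.edgeSet, c ∉ e → Disjoint (E.arc e) (D c) := by
    intro c hc e he hce
    rw [Set.disjoint_union_right]
    refine ⟨?_, (hpc c hc).2.2 e he hce⟩
    rw [Set.disjoint_left]
    exact fun z hz hz' => hz' (arcI e he hz)
  have p0D : ∀ e ∈ G.edgeSet, p0 ∉ E.arc e := fun e he h => hp0.1 (arcI e he h)
  refine Realz.noMin (rep := rep) (A := A) ⟨?_, ?_, ?_, ?_⟩
  · rintro (_ | a) (_ | b) h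
    · rfl
    · have h' : p0 = E.pos b := h
      exact absurd (h' ▸ posI b) hp0.1
    · have h' : E.pos a = p0 := h
      exact absurd (h' ▸ posI a) hp0.1
    · exact congrArg some (E.pos_inj h)
  · rintro (_ | a) (_ | b) h
    · exact h.elim
    · exact jD b h
    · exact (jD a h).symm
    · refine (arc_pathConn E (e := s(a, b)) h).joinedIn _ (pos_mem_arc E h) _ ?_
      rw [Sym2.eq_swap]; exact pos_mem_arc E h.symm
  · rintro (_ | a) (_ | b) (_ | w) h h1 h2
    · exact h.elim
    · exact h.elim
    · exact absurd rfl h1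
    · exact pD b h w (fun e => h2 (congrArg some e))
    · exact absurd rfl h2
    · exact pD a h w (fun e => h1 (congrArg some e))
    · exact p0D _ h
    · intro h3
      have := E.arc_inter_pos _ h w h3
      rw [Sym2.mem_iff] at this
      rcases this with rfl | rfl
      · exact h1 rfl
      · exact h2 rfl
  · have nm : ∀ a b c : V, (some a : Option V) ≠ some c → (some b : Option V) ≠ some c →
        c ∉ s(a, b) := by
      intro a b c h1 h2 h3
      rw [Sym2.mem_iff] at h3
      rcases h3 with rfl | rfl
      · exact h1 rfl
      · exact h2 rfl
    rintro (_ | a) (_ | b) (_ | c) (_ | d) h h' h1 h2 h3 h4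
    all_goals first | exact h.elim | exact h'.elim | exact absurd rfl h1 | exact absurd rfl h2 | exact absurd rfl h3 | exact absurd rfl h4 | skip
    · exact (dD b h s(c, d) h' (nm _ _ _ h3.symm h4.symm)).symm
    · exact (dD a h s(c, d) h' (nm _ _ _ h1.symm h2.symm)).symm
    · exact dD d h' s(a, b) h (nm _ _ _ h2 h4)
    · exact dD c h' s(a, b) h (nm _ _ _ h1 h3)
    · rw [Set.disjoint_left]
      intro z hz hz'
      have hne : s(a, b) ≠ s(c, d) := by
        intro e
        exact nm a b c h1 h3 (e ▸ Sym2.mem_mk_left c d)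
      obtain ⟨v, hv, hv', -⟩ := E.arc_inter_arc _ h _ h' hne z ⟨hz, hz'⟩
      rw [Sym2.mem_iff] at hv'
      rcases hv' with rfl | rfl
      · exact nm a b _ h1 h3 hv
      · exact nm a b _ h2 h4 hv

end topo
end TL

/-- two vertices of the outer cycle with lists of size two. -/
theorem two_lists_of_size_two {V : Type} [Fintype V] (G : SimpleGraph V)
    (E : PlaneEmbedding G) {w : V} (C : G.Walk w w) (hC : E.IsOuterCycle C)
    (v₁ v₂ : V) (hv₁ : v₁ ∈ C.support) (hv₂ : v₂ ∈ C.support)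
    (L : V → Finset ℕ) (hL0 : ∀ v : V, (L v).Nonempty)
    (h5 : ∀ v : V, v ∉ C.support → 5 ≤ (L v).card)
    (h3 : ∀ v ∈ C.support, v ≠ v₁ → v ≠ v₂ → 3 ≤ (L v).card)
    (h1 : (L v₁).card = 2) (h2 : (L v₂).card = 2) :
    ∃ φ : V → ℕ, IsLColoring G L φ := by
  classical
  obtain ⟨hcyc, hfr⟩ := hC
  -- every vertex of the cycle has a neighbour on the cycle
  have hnb : ∀ c ∈ C.support, ∃ x ∈ C.support, s(c, x) ∈ C.edges := by
    intro c hc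
    have hne : ¬ C.Nil := hcyc.not_nil
    obtain ⟨e, he, hce⟩ := (SimpleGraph.Walk.mem_support_iff_exists_mem_edges_of_not_nil hne).1 hc
    obtain ⟨x, rfl⟩ := hce
    exact ⟨x, C.snd_mem_support_of_mem_edges he, he⟩
  have hfro : ∀ c ∈ C.support, E.pos c ∈ closure E.outerFace := by
    intro c hc
    obtain ⟨x, -, hx⟩ := hnb c hc
    apply frontier_subset_closure
    rw [← hfr]
    simp only [mem_iUnion]
    exact ⟨_, hx, TL.pos_mem_arc E (C.adj_of_mem_edges hx)⟩
  obtain ⟨p0, hp0⟩ : E.outerFace.Nonempty :=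
    closure_nonempty_iff.1 ⟨_, hfro v₁ hv₁⟩
  have hno := TL.cone_noMin E (K := {c | c ∈ C.support}) hfro hp0
  obtain ⟨x, hx, hvx⟩ := hnb v₂ hv₂
  have hst : TL.St (TL.cone G {c | c ∈ C.support}) (Finset.univ.image some)
      (C.support.toFinset.image some) {none} := by
    refine ⟨?_, TL.conn_singleton _, ?_, ?_⟩
    · exact Finset.image_subset_image (Finset.subset_univ _)
    · simp
    · intro b hb
      obtain ⟨c, hc, rfl⟩ := Finset.mem_image.1 hb
      exact ⟨none, rfl, List.mem_toFinset.1 hc⟩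
  have hm : ∀ c ∈ C.support, some c ∈ C.support.toFinset.image some := fun c hc =>
    Finset.mem_image_of_mem _ (List.mem_toFinset.2 hc)
  obtain ⟨φ, hφ1, hφ2⟩ := TL.two_lists (L := fun o => o.elim ∅ L) hno hst (hm _ hv₁) (hm _ hv₂)
    (hm _ hx) (C.adj_of_mem_edges hvx) h1.ge h2.ge
    (by
      intro v hv a b
      obtain ⟨c, hc, rfl⟩ := Finset.mem_image.1 hv
      exact h3 c (List.mem_toFinset.1 hc) (fun e => a (congrArg some e))
        (fun e => b (congrArg some e)))
    (by
      intro v hv hvB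
      obtain ⟨c, -, rfl⟩ := Finset.mem_image.1 hv
      exact h5 c fun hc => hvB (hm _ hc))
  have hU : ∀ v : V, some v ∈ (Finset.univ : Finset V).image some := fun v =>
    Finset.mem_image_of_mem _ (Finset.mem_univ v)
  exact ⟨fun v => φ (some v), fun v => hφ1 _ (hU v), fun u v huv => hφ2 _ (hU u) _ (hU v) huv⟩
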